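/- Let F be a division ring that is a classical right quotient ring of the ring ℍ[X] of polynomial functions on Hamilton's quaternions ℍ (via an injective ring homomorphism φ : ℍ[X] → F). Then for every finite group G there exist a division ring M and an injective ring homomorphism ι : F → M such that the extension M/F is Galois with Galois group isomorphic to G. -/

import Mathlib

universe u v w x

/-- The subgroup of ring automorphisms of `M` fixing the image of `ι` pointwise
(the Galois group of the extension `M/F` given by `ι`). -/
def fixingAut {F M : Type*} [DivisionRing F] [DivisionRing M] (ι : F →+* M) :
    Subgroup (RingAut M) where
  carrier := {σ | ∀ x : F, σ (ι x) = ι x}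
  one_mem' := fun _ => rfl
  mul_mem' := by
    intro a b ha hb x
    show a (b (ι x)) = ι x
    rw [hb x, ha x]
  inv_mem' := by
    intro a ha x
    show a.symm (ι x) = ι x
    conv_lhs => rw [← ha x]
    exact a.symm_apply_apply _

/-- The extension `M/F` given by `ι : F →+* M` is Galois: every element of `M` fixed by all
ring automorphisms of `M` fixing `ι(F)` pointwise lies in `ι(F)`. -/
def IsGaloisExt {F M : Type*} [DivisionRing F] [DivisionRing M] (ι : F →+* M) : Prop :=
  ∀ m : M, (∀ σ ∈ fixingAut ι, σ m = m) → m ∈ Set.range ι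

/-- The ring `H[X]` of polynomial functions on a division ring `H`: the subring of `H → H`
(with pointwise operations) generated by the constant functions and the identity function. -/
def polyFunRing (H : Type*) [DivisionRing H] : Subring (H → H) :=
  Subring.closure ({f | ∃ c : H, f = Function.const H c} ∪ {id})

/-- `F` is a classical right quotient ring of `R` via the injective ring homomorphism `φ`:
every element of `F` is of the form `φ a * (φ b)⁻¹` with `b ≠ 0`. -/
def IsClassicalRightQuotient {R F : Type*} [Ring R] [DivisionRing F] (φ : R →+* F) : Prop :=
  Function.Injective φ ∧ ∀ x : F, ∃ a b : R, b ≠ 0 ∧ x = φ a * (φ b)⁻¹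

/-- Auxiliary construction for the iterated polynomial ring. -/
noncomputable def IterPolyAux (H : Type u) [Ring H] : ℕ → ((T : Type u) × Ring T)
  | 0 => ⟨H, inferInstance⟩
  | n + 1 =>
    letI := (IterPolyAux H n).2
    ⟨Polynomial (IterPolyAux H n).1, inferInstance⟩

/-- The iterated polynomial ring `H_c[t₁, …, t_n]` in `n` central variables over `H`:
`IterPoly H 0 = H` and `IterPoly H (n + 1) = Polynomial (IterPoly H n)`. -/
def IterPoly (H : Type u) [Ring H] (n : ℕ) : Type u := (IterPolyAux H n).1

noncomputable instance (H : Type u) [Ring H] (n : ℕ) : Ring (IterPoly H n) :=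
  (IterPolyAux H n).2

section InverseGalois

open Metric Set Complex Filter Topology

section CauchyTransform

variable {E : Type*} [NormedAddCommGroup E] [NormedSpace ℂ E]

/-- The Cauchy transform of the restriction of `F` to the circle of centre `c` and radius `R`. -/
noncomputable def cauchyTransform (c : ℂ) (R : ℝ) (F : ℂ → E) (z : ℂ) : E :=
  (2 * Real.pi * I : ℂ)⁻¹ • ∮ ζ in C(c, R), (ζ - z)⁻¹ • F ζ

variable {c z : ℂ} {R : ℝ} {F F' : ℂ → E}

theorem continuousOn_cauchyKernel (hF : ContinuousOn F (sphere c R)) (hz : z ∉ sphere c R) :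
    ContinuousOn (fun ζ => (ζ - z)⁻¹ • F ζ) (sphere c R) := by
  refine ContinuousOn.smul (ContinuousOn.inv₀ (by fun_prop) ?_) hF
  intro ζ hζ h
  rw [sub_eq_zero] at h
  exact hz (h ▸ hζ)

theorem cauchyTransform_sub (hR : 0 ≤ R) (hF : ContinuousOn F (sphere c R))
    (hF' : ContinuousOn F' (sphere c R)) (hz : z ∉ sphere c R) :
    cauchyTransform c R (fun ζ => F ζ - F' ζ) z
      = cauchyTransform c R F z - cauchyTransform c R F' z := by
  unfold cauchyTransform
  rw [← smul_sub, ← circleIntegral.integral_sub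
    ((continuousOn_cauchyKernel hF hz).circleIntegrable hR)
    ((continuousOn_cauchyKernel hF' hz).circleIntegrable hR)]
  simp only [smul_sub]

theorem cauchyTransform_congr (hR : 0 ≤ R) (h : EqOn F F' (sphere c R)) :
    cauchyTransform c R F z = cauchyTransform c R F' z := by
  unfold cauchyTransform
  congr 1
  exact circleIntegral.integral_congr hR fun ζ hζ => by simp only [h hζ]

theorem clm_cauchyTransform [CompleteSpace E] (hR : 0 ≤ R) (A : E →L[ℂ] E)
    (hF : ContinuousOn F (sphere c R)) (hz : z ∉ sphere c R) :
    A (cauchyTransform c R F z) = cauchyTransform c R (fun ζ => A (F ζ)) z := by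
  unfold cauchyTransform
  rw [map_smul]
  congr 1
  unfold circleIntegral
  rw [← ContinuousLinearMap.intervalIntegral_comp_comm]
  · simp
  · exact ((continuousOn_cauchyKernel hF hz).circleIntegrable hR).out

theorem norm_cauchyTransform_le {C d : ℝ} (hR : 0 ≤ R) (hd : 0 < d)
    (hF : ∀ ζ ∈ sphere c R, ‖F ζ‖ ≤ C) (hz : ∀ ζ ∈ sphere c R, d ≤ ‖ζ - z‖) :
    ‖cauchyTransform c R F z‖ ≤ R * (C / d) := by
  refine circleIntegral.norm_two_pi_i_inv_smul_integral_le_of_norm_le_const hR fun ζ hζ => ?_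
  rw [norm_smul, norm_inv, div_eq_inv_mul]
  have h1 := hz ζ hζ
  have h2 := hF ζ hζ
  have : 0 ≤ C := (norm_nonneg _).trans h2
  gcongr

theorem differentiableAt_cauchyTransform [CompleteSpace E] (hR : 0 ≤ R)
    (hF : ContinuousOn F (sphere c R))
    (hz : z ∉ sphere c R) : DifferentiableAt ℂ (cauchyTransform c R F) z := by
  have hopen : (sphere c R)ᶜ ∈ 𝓝 z := isClosed_sphere.isOpen_compl.mem_nhds hz
  obtain ⟨d, hd, hball⟩ := Metric.mem_nhds_iff.1 hopen
  have hdist : ∀ ζ ∈ sphere c R, d ≤ ‖ζ - z‖ := by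
    intro ζ hζ
    by_contra! h
    exact hball (by rwa [mem_ball, dist_eq_norm]) hζ
  have hdist' : ∀ ζ ∈ sphere c R, ∀ y ∈ ball z (d / 2), d / 2 ≤ ‖ζ - y‖ := by
    intro ζ hζ y hy
    rw [mem_ball, dist_eq_norm] at hy
    have h1 := hdist ζ hζ
    have h2 : ‖ζ - z‖ ≤ ‖ζ - y‖ + ‖y - z‖ := by simpa using norm_add_le (ζ - y) (y - z)
    linarith
  obtain ⟨C, hC⟩ := (isCompact_sphere c R).exists_bound_of_continuousOn hF
  have hsq : ∀ y ∉ sphere c R, ContinuousOn (fun ζ => (ζ - y)⁻¹ • F ζ) (sphere c R) :=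
    fun y hy => continuousOn_cauchyKernel hF hy
  refine HasDerivAt.differentiableAt
    (f' := cauchyTransform c R (fun ζ => (ζ - z)⁻¹ • F ζ) z) ?_
  rw [hasDerivAt_iff_isLittleO]
  have key : ∀ y ∈ ball z (d / 2), cauchyTransform c R F y - cauchyTransform c R F z
      - (y - z) • cauchyTransform c R (fun ζ => (ζ - z)⁻¹ • F ζ) z
      = (y - z) ^ 2 • cauchyTransform c R (fun ζ => (ζ - z)⁻¹ • (ζ - z)⁻¹ • F ζ) y := by
    intro y hy
    have hy' : y ∉ sphere c R := fun h => by
      have := hdist' y h y hy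
      simp at this; linarith
    have i1 := (hsq y hy').circleIntegrable hR
    have i2 := (hsq z hz).circleIntegrable hR
    have i3 : CircleIntegrable (fun ζ => (ζ - y)⁻¹ • F ζ - (ζ - z)⁻¹ • F ζ) c R := i1.sub i2
    have i4 : CircleIntegrable (fun ζ => (y - z) • (ζ - z)⁻¹ • (ζ - z)⁻¹ • F ζ) c R :=
      ((continuousOn_cauchyKernel (hsq z hz) hz).const_smul (y - z)).circleIntegrable hR
    unfold cauchyTransform
    rw [smul_comm (y - z), smul_comm ((y - z) ^ 2), ← smul_sub, ← smul_sub,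
      ← circleIntegral.integral_sub i1 i2, ← circleIntegral.integral_smul,
      ← circleIntegral.integral_smul, ← circleIntegral.integral_sub i3 i4]
    congr 1
    refine circleIntegral.integral_congr hR fun ζ hζ => ?_
    have n1 : ζ - y ≠ 0 := fun h => hy' (sub_eq_zero.1 h ▸ hζ)
    have n2 : ζ - z ≠ 0 := fun h => hz (sub_eq_zero.1 h ▸ hζ)
    simp only [smul_smul, ← sub_smul]
    congr 1
    field_simp
    ring
  have hev : ∀ᶠ y in 𝓝 z, y ∈ ball z (d / 2) := ball_mem_nhds z (by positivity)
  have hO : (fun y => cauchyTransform c R F y - cauchyTransform c R F z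
      - (y - z) • cauchyTransform c R (fun ζ => (ζ - z)⁻¹ • F ζ) z)
      =O[𝓝 z] fun y => (y - z) ^ 2 := by
    refine Asymptotics.IsBigO.of_bound (R * (((d⁻¹ * (d⁻¹ * C))) / (d / 2))) ?_
    filter_upwards [hev] with y hy
    rw [key y hy, norm_smul, mul_comm]
    gcongr
    refine norm_cauchyTransform_le hR (by positivity) (fun ζ hζ => ?_)
      (fun ζ hζ => hdist' ζ hζ y hy)
    rw [norm_smul, norm_smul, norm_inv]
    have := hdist ζ hζ
    have := hC ζ hζ
    gcongr
  refine hO.trans_isLittleO ?_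
  have : (fun y : ℂ => (y - z) ^ 2) =o[𝓝 z] fun y => (y - z) ^ 1 :=
    (Asymptotics.isLittleO_pow_pow one_lt_two).comp_tendsto
      (by simpa using (tendsto_id (x := 𝓝 z)).sub_const z)
  simpa using this

theorem cauchyTransform_eq_zero (hR : 0 ≤ R) (hF : DifferentiableOn ℂ F (closedBall c R))
    (hz : z ∉ closedBall c R) : cauchyTransform c R F z = 0 := by
  have hd : DifferentiableOn ℂ (fun ζ => (ζ - z)⁻¹ • F ζ) (closedBall c R) := by
    refine DifferentiableOn.smul (DifferentiableOn.inv (by fun_prop) ?_) hF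
    intro ζ hζ h
    exact hz (sub_eq_zero.1 h ▸ hζ)
  unfold cauchyTransform
  rw [DiffContOnCl.circleIntegral_eq_zero hR
    (DifferentiableOn.diffContOnCl (hd.mono closure_ball_subset_closedBall)), smul_zero]

theorem cauchyTransform_sub_of_annulus [CompleteSpace E] {r R : ℝ} (hr : 0 < r) {U : Set ℂ}
    (hU : IsOpen U)
    (hF : DifferentiableOn ℂ F U) (hsub : closedBall c R \ ball c r ⊆ U)
    (hz : z ∈ ball c R) (hz' : z ∉ closedBall c r) :
    cauchyTransform c R F z - cauchyTransform c r F z = F z := by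
  have hrR : r ≤ R := by
    simp only [mem_ball, mem_closedBall, not_le] at hz hz'
    linarith
  have hzU : z ∈ U := hsub ⟨ball_subset_closedBall hz, fun h => hz' (ball_subset_closedBall h)⟩
  have hds := (differentiableOn_dslope (hU.mem_nhds hzU)).2 hF
  have heq := circleIntegral_eq_of_differentiable_on_annulus_off_countable hr hrR countable_empty
    (f := dslope F z) (hds.continuousOn.mono hsub) (fun y hy => by
      refine hds.differentiableAt (hU.mem_nhds (hsub ⟨ball_subset_closedBall hy.1.1, fun h =>
        hy.1.2 (ball_subset_closedBall h)⟩)))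
  have hsp : ∀ ρ, r ≤ ρ → ρ ≤ R → sphere c ρ ⊆ U := by
    intro ρ h1 h2 ζ hζ
    apply hsub
    simp only [mem_sphere, Set.mem_sdiff, mem_closedBall, mem_ball] at *
    constructor <;> linarith
  have hexp : ∀ ρ, r ≤ ρ → ρ ≤ R → z ∉ sphere c ρ →
      cauchyTransform c ρ F z = (2 * Real.pi * I : ℂ)⁻¹ • (∮ ζ in C(c, ρ), dslope F z ζ)
        + cauchyTransform c ρ (fun _ => F z) z := by
    intro ρ h1 h2 h3
    have h0 : 0 ≤ ρ := hr.le.trans h1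
    unfold cauchyTransform
    rw [← smul_add, ← circleIntegral.integral_add
      ((hds.continuousOn.mono (hsp ρ h1 h2)).circleIntegrable h0)
      ((continuousOn_cauchyKernel continuousOn_const h3).circleIntegrable h0)]
    congr 1
    refine circleIntegral.integral_congr h0 fun ζ hζ => ?_
    have : ζ ≠ z := fun h => h3 (h ▸ hζ)
    simp only [dslope_of_ne _ this, slope, vsub_eq_sub]
    rw [← smul_add, sub_add_cancel]
  have z1 : z ∉ sphere c R := fun h => by
    simp only [mem_ball, mem_sphere] at hz h; linarith
  have z2 : z ∉ sphere c r := fun h => hz' (sphere_subset_closedBall h)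
  rw [hexp R hrR le_rfl z1, hexp r le_rfl hrR z2, heq,
    cauchyTransform_eq_zero hr.le (differentiableOn_const _) hz', add_zero, add_sub_cancel_left]
  exact DiffContOnCl.two_pi_i_inv_smul_circleIntegral_sub_inv_smul
    (diffContOnCl_const) hz

end CauchyTransform

section Patching

variable {E : Type*} [NormedAddCommGroup E] [NormedSpace ℂ E]

/-- The correction to a section near the disc of centre `c`, where the frame changes by `B`. -/
noncomputable def patchCorrection (c : ℂ) (B B' : ℂ → E →L[ℂ] E) (P : ℂ → E) (z : ℂ) : E :=
  B z (cauchyTransform c 1 (fun ζ => B' ζ (P ζ)) z) - cauchyTransform c 1 P z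

variable {c z : ℂ} {B B' : ℂ → E →L[ℂ] E} {P P' : ℂ → E}

theorem continuousOn_clm_apply_sphere (hB' : DifferentiableOn ℂ B' (closedBall c (1 / 2))ᶜ)
    (hP : ContinuousOn P (sphere c 1)) : ContinuousOn (fun ζ => B' ζ (P ζ)) (sphere c 1) := by
  refine ContinuousOn.clm_apply (hB'.continuousOn.mono fun ζ hζ => ?_) hP
  simp only [mem_compl_iff, mem_closedBall, mem_sphere] at *
  rw [hζ]; norm_num

theorem patchCorrection_sub (hB' : DifferentiableOn ℂ B' (closedBall c (1 / 2))ᶜ)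
    (hP : ContinuousOn P (sphere c 1)) (hP' : ContinuousOn P' (sphere c 1))
    (hz : z ∉ sphere c 1) :
    patchCorrection c B B' P z - patchCorrection c B B' P' z
      = patchCorrection c B B' (fun ζ => P ζ - P' ζ) z := by
  unfold patchCorrection
  simp only [map_sub]
  rw [cauchyTransform_sub zero_le_one hP hP' hz,
    cauchyTransform_sub zero_le_one (continuousOn_clm_apply_sphere hB' hP)
      (continuousOn_clm_apply_sphere hB' hP') hz, map_sub]
  abel

variable [CompleteSpace E]

theorem patchCorrection_eq (hB' : DifferentiableOn ℂ B' (closedBall c (1 / 2))ᶜ)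
    (hP : ContinuousOn P (sphere c 1)) (hz : z ∉ sphere c 1) :
    patchCorrection c B B' P z
      = cauchyTransform c 1 (fun ζ => B z (B' ζ (P ζ)) - P ζ) z := by
  have h := continuousOn_clm_apply_sphere hB' hP
  unfold patchCorrection
  rw [clm_cauchyTransform zero_le_one _ h hz, ← cauchyTransform_sub zero_le_one _ hP hz]
  exact (B z).continuous.comp_continuousOn h

theorem norm_patchCorrection_le (hB' : DifferentiableOn ℂ B' (closedBall c (1 / 2))ᶜ) {δ C d : ℝ}
    (hδ : ∀ ζ ∈ sphere c 1, ‖B z * B' ζ - 1‖ ≤ δ)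
    (hP : ContinuousOn P (sphere c 1)) (hC : ∀ ζ ∈ sphere c 1, ‖P ζ‖ ≤ C) (hd : 0 < d)
    (hz : 1 + d ≤ dist z c) :
    ‖patchCorrection c B B' P z‖ ≤ δ * C / d := by
  have hz' : z ∉ sphere c 1 := fun h => by rw [mem_sphere] at h; linarith
  rw [patchCorrection_eq hB' hP hz', ← one_mul (δ * C / d)]
  refine norm_cauchyTransform_le zero_le_one hd (fun ζ hζ => ?_) (fun ζ hζ => ?_)
  · have h1 := (B z * B' ζ - 1).le_opNorm (P ζ)
    have h2 := hδ ζ hζ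
    have h3 := hC ζ hζ
    have h4 : 0 ≤ δ := (norm_nonneg _).trans h2
    refine h1.trans ?_
    gcongr
  · rw [← dist_eq_norm]
    have := dist_triangle z ζ c
    rw [mem_sphere.1 hζ, dist_comm z ζ] at this
    linarith

theorem differentiableAt_patchCorrection (hB : DifferentiableOn ℂ B (closedBall c (1 / 2))ᶜ)
    (hB' : DifferentiableOn ℂ B' (closedBall c (1 / 2))ᶜ) (hP : ContinuousOn P (sphere c 1))
    (hz : 1 < dist z c) : DifferentiableAt ℂ (patchCorrection c B B' P) z := by
  have hz' : z ∉ sphere c 1 := fun h => by rw [mem_sphere] at h; linarith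
  have h1 : DifferentiableAt ℂ B z := hB.differentiableAt
    (isClosed_closedBall.isOpen_compl.mem_nhds (by
      simp only [mem_compl_iff, mem_closedBall, not_le]; linarith))
  exact (h1.clm_apply (differentiableAt_cauchyTransform zero_le_one
    (continuousOn_clm_apply_sphere hB' hP) hz')).sub
    (differentiableAt_cauchyTransform zero_le_one hP hz')

/-- Cartan-type patching: a vector bundle on the projective line, given by transition functions
near the identity on finitely many well-separated circles, has a global section with prescribed
value at infinity. -/
theorem exists_patched_section {ι : Type*} [Fintype ι] {c : ι → ℂ}
    (hc : ∀ i j, i ≠ j → 4 ≤ dist (c i) (c j)) {B B' : ι → ℂ → E →L[ℂ] E}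
    (hB : ∀ i, DifferentiableOn ℂ (B i) (closedBall (c i) (1 / 2))ᶜ)
    (hB' : ∀ i, DifferentiableOn ℂ (B' i) (closedBall (c i) (1 / 2))ᶜ)
    (hinv : ∀ i, ∀ z ∉ closedBall (c i) (1 / 2), B i z * B' i z = 1) {δ : ℝ} (hδ0 : 0 ≤ δ)
    (hδ : ∀ i z ζ, 1 ≤ dist z (c i) → dist ζ (c i) = 1 → ‖B i z * B' i ζ - 1‖ ≤ δ)
    (hδ1 : Fintype.card ι * δ < 1) (v : E) :
    ∃ (f : ℂ → E) (k : ι → ℂ → E),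
      DifferentiableOn ℂ f {z | ∀ i, 1 < dist z (c i)} ∧
      (∀ i, DifferentiableOn ℂ (k i) (ball (c i) 2)) ∧
      (∀ i z, z ∈ ball (c i) 2 → 1 < dist z (c i) → f z = B i z (k i z)) ∧
      Tendsto f (Bornology.cobounded ℂ) (𝓝 v) := by
  classical
  let ext : ((i : ι) → C(sphere (c i) 1, E)) → ι → ℂ → E :=
    fun p i ζ => if h : ζ ∈ sphere (c i) 1 then p i ⟨ζ, h⟩ else 0
  have ext_cont : ∀ p i, ContinuousOn (ext p i) (sphere (c i) 1) := by
    intro p i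
    rw [continuousOn_iff_continuous_domRestrict]
    convert (p i).continuous using 1
    funext ζ
    exact dif_pos ζ.2
  have hfar : ∀ i j z, i ≠ j → dist z (c i) < 3 → 1 < dist z (c j) := by
    intro i j z hij hz
    have h1 := hc i j hij
    have h2 := dist_triangle (c i) z (c j)
    rw [dist_comm (c i) z] at h2
    linarith
  let q : ((i : ι) → C(sphere (c i) 1, E)) → ι → ℂ → E := fun p i z =>
    v + ∑ j ∈ Finset.univ.erase i, patchCorrection (c j) (B j) (B' j) (ext p j) z
  have q_diff : ∀ p i, DifferentiableOn ℂ (q p i) (ball (c i) 3) := by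
    intro p i z hz
    refine DifferentiableAt.differentiableWithinAt ?_
    refine DifferentiableAt.const_add _ (DifferentiableAt.fun_sum fun j hj => ?_)
    exact differentiableAt_patchCorrection (hB j) (hB' j) (ext_cont p j)
      (hfar i j z (Finset.ne_of_mem_erase hj).symm hz)
  let T : ((i : ι) → C(sphere (c i) 1, E)) → (i : ι) → C(sphere (c i) 1, E) := fun p i =>
    ⟨fun ζ => q p i ζ, by
      have : ContinuousOn (q p i) (sphere (c i) 1) := (q_diff p i).continuousOn.mono
        fun ζ hζ => by rw [mem_ball, mem_sphere.1 hζ]; norm_num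
      exact continuousOn_iff_continuous_domRestrict.1 this⟩
  have hT : ContractingWith ⟨Fintype.card ι * δ, by positivity⟩ T := by
    refine ⟨by exact_mod_cast hδ1, LipschitzWith.of_dist_le_mul fun p p' => ?_⟩
    have hnn : 0 ≤ Fintype.card ι * δ * dist p p' := by positivity
    change dist (T p) (T p') ≤ Fintype.card ι * δ * dist p p'
    rw [dist_pi_le_iff hnn]
    intro i
    rw [ContinuousMap.dist_le hnn]
    rintro ⟨z, hz⟩
    change dist (q p i z) (q p' i z) ≤ _
    simp only [q, dist_add_left]
    rw [dist_eq_norm, ← Finset.sum_sub_distrib, mul_assoc]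
    have hbound : ∀ j ∈ Finset.univ.erase i,
        ‖patchCorrection (c j) (B j) (B' j) (ext p j) z
          - patchCorrection (c j) (B j) (B' j) (ext p' j) z‖ ≤ δ * dist p p' := by
      intro j hj
      have hz3 : 1 + 1 ≤ dist z (c j) := by
        have h1 := hc i j (Finset.ne_of_mem_erase hj).symm
        have h2 := dist_triangle (c i) z (c j)
        rw [dist_comm (c i) z, mem_sphere.1 hz] at h2
        linarith
      have hz' : z ∉ sphere (c j) 1 := fun h => by rw [mem_sphere] at h; linarith
      rw [patchCorrection_sub (hB' j) (ext_cont p j) (ext_cont p' j) hz',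
        ← div_one (δ * dist p p')]
      refine norm_patchCorrection_le (hB' j) (fun ζ hζ => hδ j z ζ (by linarith) hζ)
        ((ext_cont p j).sub (ext_cont p' j)) (fun ζ hζ => ?_) one_pos hz3
      simp only [ext, dif_pos hζ, ← dist_eq_norm]
      exact (ContinuousMap.dist_apply_le_dist _).trans (dist_le_pi_dist p p' j)
    refine (norm_sum_le_of_le _ hbound).trans ?_
    rw [Finset.sum_const, nsmul_eq_mul]
    gcongr
    exact Finset.card_le_univ _
  obtain ⟨p, hp, -⟩ := hT.exists_fixedPoint 0 (edist_ne_top _ _)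
  have hpq : ∀ i, EqOn (ext p i) (q p i) (sphere (c i) 1) := by
    intro i ζ hζ
    have : T p i ⟨ζ, hζ⟩ = p i ⟨ζ, hζ⟩ := by rw [hp.eq]
    simp only [ext, dif_pos hζ]
    exact this.symm
  refine ⟨fun z => v + ∑ j, patchCorrection (c j) (B j) (B' j) (ext p j) z,
    fun i => cauchyTransform (c i) 2 (fun ζ => B' i ζ (q p i ζ)), ?_, ?_, ?_, ?_⟩
  · intro z hz
    refine DifferentiableAt.differentiableWithinAt ?_
    exact DifferentiableAt.const_add _ (DifferentiableAt.fun_sum fun j _ =>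
      differentiableAt_patchCorrection (hB j) (hB' j) (ext_cont p j) (hz j))
  · intro i z hz
    refine (differentiableAt_cauchyTransform zero_le_two ?_ fun h => ?_).differentiableWithinAt
    · refine ContinuousOn.clm_apply ((hB' i).continuousOn.mono fun ζ hζ => ?_)
        ((q_diff p i).continuousOn.mono fun ζ hζ => ?_)
      · simp only [mem_compl_iff, mem_closedBall, mem_sphere] at *
        rw [hζ]; norm_num
      · rw [mem_ball, mem_sphere.1 hζ]; norm_num
    · rw [mem_ball] at hz
      rw [mem_sphere] at h
      linarith
  · intro i z hz hz1
    have hz2 : z ∉ closedBall (c i) (1 / 2) := by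
      rw [mem_closedBall]; linarith
    have h0 : cauchyTransform (c i) 1 (ext p i) z = 0 := by
      rw [cauchyTransform_congr zero_le_one (hpq i)]
      refine cauchyTransform_eq_zero zero_le_one ((q_diff p i).mono ?_) ?_
      · exact closedBall_subset_ball (by norm_num)
      · rw [mem_closedBall]; linarith
    have h1 : cauchyTransform (c i) 1 (fun ζ => B' i ζ (ext p i ζ)) z
        = cauchyTransform (c i) 1 (fun ζ => B' i ζ (q p i ζ)) z :=
      cauchyTransform_congr zero_le_one fun ζ hζ => by simp only [hpq i hζ]
    have h2 : cauchyTransform (c i) 2 (fun ζ => B' i ζ (q p i ζ)) z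
        - cauchyTransform (c i) 1 (fun ζ => B' i ζ (q p i ζ)) z = B' i z (q p i z) := by
      refine cauchyTransform_sub_of_annulus one_pos
        (U := ball (c i) 3 ∩ (closedBall (c i) (1 / 2))ᶜ)
        (isOpen_ball.inter isClosed_closedBall.isOpen_compl) ?_ ?_ hz ?_
      · exact ((hB' i).mono inter_subset_right).clm_apply ((q_diff p i).mono inter_subset_left)
      · intro ζ hζ
        simp only [Set.mem_sdiff, mem_closedBall, mem_ball, mem_inter_iff, mem_compl_iff,
          not_lt, not_le] at *
        constructor <;> linarith
      · rw [mem_closedBall]; linarith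
    have h3 : B i z (B' i z (q p i z)) = q p i z := congrArg (fun A => A (q p i z)) (hinv i z hz2)
    have h4 : v + ∑ j, patchCorrection (c j) (B j) (B' j) (ext p j) z
        = q p i z + patchCorrection (c i) (B i) (B' i) (ext p i) z := by
      simp only [q]
      rw [add_assoc, Finset.sum_erase_add _ _ (Finset.mem_univ i)]
    change v + ∑ j, patchCorrection (c j) (B j) (B' j) (ext p j) z = _
    have h5 : cauchyTransform (c i) 1 (fun ζ => B' i ζ (q p i ζ)) z
        = cauchyTransform (c i) 2 (fun ζ => B' i ζ (q p i ζ)) z - B' i z (q p i z) := by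
      rw [← h2]; abel
    rw [h4, patchCorrection, h0, h1, sub_zero, h5, map_sub, h3]
    abel
  · suffices h : ∀ j, Tendsto (patchCorrection (c j) (B j) (B' j) (ext p j))
        (Bornology.cobounded ℂ) (𝓝 0) by
      simpa using (tendsto_const_nhds (x := v)).add (tendsto_finsetSum Finset.univ fun j _ => h j)
    intro j
    obtain ⟨C, hC⟩ := (isCompact_sphere (c j) 1).exists_bound_of_continuousOn (ext_cont p j)
    have hlim : Tendsto (fun z => dist z (c j) - 1) (Bornology.cobounded ℂ) atTop :=
      tendsto_atTop_add_const_right _ _ (tendsto_dist_right_cobounded_atTop (c j))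
    refine squeeze_zero_norm' ?_ (hlim.const_div_atTop (δ * C))
    filter_upwards [hlim.eventually_gt_atTop 0] with z hz
    exact norm_patchCorrection_le (hB' j) (fun ζ hζ => hδ j z ζ (by linarith) hζ)
      (ext_cont p j) hC hz (by linarith)

end Patching

section MobiusRoot

/-- The principal branch of the `n`-th root of `(1 + i w) / (1 - i w)`. -/
noncomputable def mobiusRoot (n : ℕ) (w : ℂ) : ℂ := ((1 + I * w) / (1 - I * w)) ^ ((n : ℂ)⁻¹)

theorem mobiusRoot_zero (n : ℕ) : mobiusRoot n 0 = 1 := by simp [mobiusRoot]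

theorem mobiusRoot_pow {n : ℕ} (hn : n ≠ 0) (w : ℂ) :
    mobiusRoot n w ^ n = (1 + I * w) / (1 - I * w) := cpow_nat_inv_pow _ hn

theorem one_add_I_mul_ne_zero {w : ℂ} (hw : ‖w‖ < 1) : 1 + I * w ≠ 0 := by
  intro h
  have h1 : I * w = -1 := by linear_combination h
  have h2 := congrArg norm h1
  simp at h2
  linarith

theorem one_sub_I_mul_ne_zero {w : ℂ} (hw : ‖w‖ < 1) : 1 - I * w ≠ 0 := by
  have := one_add_I_mul_ne_zero (w := -w) (by simpa using hw)
  simpa [sub_eq_add_neg] using this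

theorem mobius_mem_slitPlane {w : ℂ} (hw : ‖w‖ < 1) :
    (1 + I * w) / (1 - I * w) ∈ slitPlane := by
  left
  have h0 : 0 < normSq (1 - I * w) := normSq_pos.2 (one_sub_I_mul_ne_zero hw)
  have h1 : w.re * w.re + w.im * w.im < 1 := by
    rw [← normSq_apply, normSq_eq_norm_sq]
    nlinarith [norm_nonneg w]
  rw [div_re, ← add_div]
  refine div_pos ?_ h0
  simp
  nlinarith

theorem mobiusRoot_ne_zero (n : ℕ) {w : ℂ} (hw : ‖w‖ < 1) : mobiusRoot n w ≠ 0 := by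
  rw [mobiusRoot, Ne, cpow_eq_zero_iff]
  exact fun h => slitPlane_ne_zero (mobius_mem_slitPlane hw) h.1

theorem differentiableAt_mobiusRoot (n : ℕ) {w : ℂ} (hw : ‖w‖ < 1) :
    DifferentiableAt ℂ (mobiusRoot n) w := by
  have := one_sub_I_mul_ne_zero hw
  refine DifferentiableAt.cpow_const (by fun_prop (disch := assumption)) ?_
  exact mobius_mem_slitPlane hw

theorem mobiusRoot_conj (n : ℕ) {w : ℂ} (hw : ‖w‖ < 1) :
    mobiusRoot n (starRingEnd ℂ w) = (starRingEnd ℂ (mobiusRoot n w))⁻¹ := by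
  have h := slitPlane_arg_ne_pi (mobius_mem_slitPlane hw)
  have h' : (1 + I * (starRingEnd ℂ w)) / (1 - I * (starRingEnd ℂ w))
      = starRingEnd ℂ ((1 + I * w) / (1 - I * w))⁻¹ := by
    simp [sub_eq_add_neg]
  have h2 : ((1 + I * w) / (1 - I * w))⁻¹.arg ≠ Real.pi := by
    rw [arg_inv, if_neg h]
    intro h3
    linarith [neg_pi_lt_arg ((1 + I * w) / (1 - I * w))]
  rw [mobiusRoot, h', conj_cpow _ _ h2, inv_cpow _ _ (by simpa using h), mobiusRoot, map_inv₀]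
  simp

/-- An `n`-th root of `(z - c + i ε) / (z - c - i ε)`, holomorphic for `ε < |z - c|`. -/
noncomputable def branchRoot (c ε : ℝ) (n : ℕ) (z : ℂ) : ℂ := mobiusRoot n (ε / (z - c))

variable {c ε : ℝ} {z : ℂ}

theorem norm_div_sub_lt_one (hε : 0 < ε) (hz : ε < dist z c) : ‖(ε : ℂ) / (z - c)‖ < 1 := by
  rw [norm_div, norm_real, Real.norm_of_nonneg hε.le, ← dist_eq_norm, div_lt_one (hε.trans hz)]
  exact hz

theorem branchRoot_ne_zero (n : ℕ) (hε : 0 < ε) (hz : ε < dist z c) : branchRoot c ε n z ≠ 0 :=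
  mobiusRoot_ne_zero n (norm_div_sub_lt_one hε hz)

theorem differentiableAt_branchRoot (n : ℕ) (hε : 0 < ε) (hz : ε < dist z c) :
    DifferentiableAt ℂ (branchRoot c ε n) z := by
  have h0 : z - c ≠ 0 := sub_ne_zero.2 (dist_pos.1 (hε.trans hz))
  exact (differentiableAt_mobiusRoot n (norm_div_sub_lt_one hε hz)).comp z
    (by fun_prop (disch := assumption))

theorem branchRoot_conj (n : ℕ) (hε : 0 < ε) (hz : ε < dist z c) :
    branchRoot c ε n (starRingEnd ℂ z) = (starRingEnd ℂ (branchRoot c ε n z))⁻¹ := by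
  rw [branchRoot, branchRoot, ← mobiusRoot_conj n (norm_div_sub_lt_one hε hz)]
  simp

theorem branchRoot_pow {n : ℕ} (hn : n ≠ 0) (hε : 0 < ε) (hz : ε < dist z c) :
    branchRoot c ε n z ^ n = (z - c + I * ε) / (z - c - I * ε) := by
  have h0 : z - c ≠ 0 := sub_ne_zero.2 (dist_pos.1 (hε.trans hz))
  rw [branchRoot, mobiusRoot_pow hn, ← mul_div_mul_right _ _ h0]
  congr 1 <;> field_simp

end MobiusRoot

section SpectralProjection

variable {A : Type*} [Ring A] [Algebra ℂ A] {n : ℕ} {ζ : ℂ} {a : A}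

/-- The projection onto the `ζ ^ j`-eigenspace of an element `a` with `a ^ n = 1`. -/
noncomputable def spectralProj (n : ℕ) (ζ : ℂ) (a : A) (j : ℕ) : A :=
  (n : ℂ)⁻¹ • ∑ m ∈ Finset.range n, ((ζ ^ j)⁻¹ • a) ^ m

theorem mul_spectralProj (hζ : IsPrimitiveRoot ζ n) (ha : a ^ n = 1) (hn : n ≠ 0) (j : ℕ) :
    a * spectralProj n ζ a j = ζ ^ j • spectralProj n ζ a j := by
  have h0 : ζ ^ j ≠ 0 := pow_ne_zero _ (hζ.ne_zero hn)
  have hT : ((ζ ^ j)⁻¹ • a) ^ n = 1 := by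
    rw [smul_pow, ha, inv_pow, ← pow_mul, mul_comm, pow_mul, hζ.pow_eq_one]
    simp
  have h1 : ((ζ ^ j)⁻¹ • a) * ∑ m ∈ Finset.range n, ((ζ ^ j)⁻¹ • a) ^ m
      = ∑ m ∈ Finset.range n, ((ζ ^ j)⁻¹ • a) ^ m := by
    have h2 := Finset.sum_range_succ (fun m => ((ζ ^ j)⁻¹ • a) ^ m) n
    rw [Finset.sum_range_succ', hT, pow_zero, add_left_inj] at h2
    rw [Finset.mul_sum, ← h2]
    simp only [pow_succ']
  rw [spectralProj, mul_smul_comm, smul_comm]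
  congr 1
  conv_rhs => rw [← h1, smul_mul_assoc, smul_smul, mul_inv_cancel₀ h0, one_smul]

theorem pow_mul_spectralProj (hζ : IsPrimitiveRoot ζ n) (ha : a ^ n = 1) (hn : n ≠ 0) (j m : ℕ) :
    a ^ m * spectralProj n ζ a j = (ζ ^ m) ^ j • spectralProj n ζ a j := by
  rw [← pow_mul, mul_comm, pow_mul]
  induction m with
  | zero => simp
  | succ m ih =>
    rw [pow_succ, mul_assoc, mul_spectralProj hζ ha hn, mul_smul_comm, ih, smul_smul, pow_succ']

theorem geom_sum_primitiveRoot (hζ : IsPrimitiveRoot ζ n) {j k : ℕ} (hj : j < n) (hk : k < n) :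
    ∑ m ∈ Finset.range n, ((ζ ^ j)⁻¹ * ζ ^ k) ^ m = if j = k then (n : ℂ) else 0 := by
  have hn : n ≠ 0 := by lia
  have h0 : ζ ^ j ≠ 0 := pow_ne_zero _ (hζ.ne_zero hn)
  split_ifs with h
  · subst h
    simp [inv_mul_cancel₀ h0]
  · have h1 : (ζ ^ j)⁻¹ * ζ ^ k ≠ 1 := by
      intro h1
      apply h
      apply hζ.pow_inj hj hk
      field_simp at h1
      exact h1.symm
    have h2 : ((ζ ^ j)⁻¹ * ζ ^ k) ^ n = 1 := by
      rw [mul_pow, inv_pow, ← pow_mul, ← pow_mul, mul_comm j, mul_comm k, pow_mul, pow_mul,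
        hζ.pow_eq_one]
      simp
    rw [geom_sum_eq h1, h2]
    simp

theorem spectralProj_mul_spectralProj (hζ : IsPrimitiveRoot ζ n) (ha : a ^ n = 1) {j k : ℕ}
    (hj : j < n) (hk : k < n) :
    spectralProj n ζ a j * spectralProj n ζ a k
      = if j = k then spectralProj n ζ a k else 0 := by
  have hn : n ≠ 0 := by lia
  have hn' : (n : ℂ) ≠ 0 := by exact_mod_cast hn
  have h : ∀ m, ((ζ ^ j)⁻¹ • a) ^ m * spectralProj n ζ a k
      = ((ζ ^ j)⁻¹ * ζ ^ k) ^ m • spectralProj n ζ a k := by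
    intro m
    rw [smul_pow, smul_mul_assoc, pow_mul_spectralProj hζ ha hn, smul_smul, mul_pow]
    congr 2
    rw [← pow_mul, ← pow_mul, mul_comm]
  conv_lhs => rw [spectralProj, smul_mul_assoc, Finset.sum_mul]
  simp only [h]
  rw [← Finset.sum_smul, geom_sum_primitiveRoot hζ hj hk]
  split_ifs <;> simp [smul_smul, hn']

theorem sum_spectralProj (hζ : IsPrimitiveRoot ζ n) (hn : n ≠ 0) :
    ∑ j ∈ Finset.range n, spectralProj n ζ a j = 1 := by
  have hn' : (n : ℂ) ≠ 0 := by exact_mod_cast hn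
  simp only [spectralProj]
  rw [← Finset.smul_sum, Finset.sum_comm]
  have h : ∀ m ∈ Finset.range n, ∑ j ∈ Finset.range n, ((ζ ^ j)⁻¹ • a) ^ m
      = if m = 0 then (n : ℂ) • (1 : A) else 0 := by
    intro m hm
    have := geom_sum_primitiveRoot hζ (Finset.mem_range.1 hm) (Nat.pos_of_ne_zero hn)
    rw [pow_zero, mul_one] at this
    simp only [smul_pow]
    rw [← Finset.sum_smul]
    simp only [inv_pow, ← pow_mul] at *
    simp only [mul_comm _ m, this]
    split_ifs with h
    · simp [h]
    · simp
  rw [Finset.sum_congr rfl h]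
  simp [Nat.pos_of_ne_zero hn, smul_smul, hn']

/-- The operator acting by `s ^ j` on the `ζ ^ j`-eigenspace of `a`, for `j < n`. -/
noncomputable def eigenScale (n : ℕ) (ζ : ℂ) (a : A) (s : ℂ) : A :=
  ∑ j ∈ Finset.range n, s ^ j • spectralProj n ζ a j

theorem eigenScale_one (hζ : IsPrimitiveRoot ζ n) (hn : n ≠ 0) : eigenScale n ζ a 1 = 1 := by
  simp [eigenScale, sum_spectralProj hζ hn]

theorem eigenScale_mul (hζ : IsPrimitiveRoot ζ n) (ha : a ^ n = 1) (s t : ℂ) :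
    eigenScale n ζ a s * eigenScale n ζ a t = eigenScale n ζ a (s * t) := by
  simp only [eigenScale, Finset.sum_mul_sum]
  refine Finset.sum_congr rfl fun j hj => ?_
  have : ∀ k ∈ Finset.range n, s ^ j • spectralProj n ζ a j * t ^ k • spectralProj n ζ a k
      = if j = k then (s * t) ^ k • spectralProj n ζ a k else 0 := by
    intro k hk
    rw [smul_mul_smul_comm, spectralProj_mul_spectralProj hζ ha (Finset.mem_range.1 hj)
      (Finset.mem_range.1 hk)]
    split_ifs with h
    · rw [h, mul_pow]
    · simp
  rw [Finset.sum_congr rfl this, Finset.sum_ite_eq, if_pos hj]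

end SpectralProjection

theorem differentiable_eigenScale {A : Type*} [NormedRing A] [NormedAlgebra ℂ A] (n : ℕ) (ζ : ℂ)
    (a : A) : Differentiable ℂ (eigenScale n ζ a) := by
  unfold eigenScale
  fun_prop

section Sections

variable {G : Type*} [Group G]

/-- Left translation on functions on a group. -/
noncomputable def leftTranslation (i : G) : (G → ℂ) →L[ℂ] (G → ℂ) :=
  ContinuousLinearMap.pi fun g => ContinuousLinearMap.proj (i * g)

theorem leftTranslation_pow_apply (i : G) (m : ℕ) (f : G → ℂ) (g : G) :
    (leftTranslation i ^ m) f g = f (i ^ m * g) := by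
  induction m generalizing g with
  | zero => simp
  | succ m ih =>
    rw [pow_succ']
    change (leftTranslation i ^ m) f (i * g) = _
    rw [ih, pow_succ, mul_assoc]

theorem leftTranslation_pow_orderOf (i : G) : leftTranslation i ^ orderOf i = 1 := by
  ext f g
  rw [leftTranslation_pow_apply, pow_orderOf_eq_one, one_mul]
  rfl

/-- The standard primitive root of unity of order `n`. -/
noncomputable def stdRoot (n : ℕ) : ℂ := exp (2 * Real.pi * I / n)

theorem isPrimitiveRoot_stdRoot {n : ℕ} (hn : n ≠ 0) : IsPrimitiveRoot (stdRoot n) n :=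
  isPrimitiveRoot_exp n hn

/-- The complement of the closed unit discs centred at the points `c i`. -/
def outerRegion (c : G → ℝ) : Set ℂ := {z | ∀ i, 1 < dist z (c i)}

variable [Finite G]

theorem exists_sections {c : G → ℝ} (hc : ∀ i j, i ≠ j → 4 ≤ dist (c i) (c j)) :
    ∃ ε : ℝ, 0 < ε ∧ ε < 1 / 2 ∧ ∀ v : G → ℂ, ∃ (f : G → ℂ → ℂ) (K : G → ℕ → G → ℂ → ℂ),
      (∀ g, DifferentiableOn ℂ (f g) (outerRegion c)) ∧
      (∀ i j g, DifferentiableOn ℂ (K i j g) (ball (c i) 2)) ∧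
      (∀ i g m (z : ℂ), dist z (c i) < 2 → 1 < dist z (c i) → f (i ^ m * g) z =
        ∑ j ∈ Finset.range (orderOf i), K i j g z *
          (stdRoot (orderOf i) ^ m * branchRoot (c i) ε (orderOf i) z) ^ j) ∧
      ∀ g, Tendsto (f g) (Bornology.cobounded ℂ) (𝓝 (v g)) := by
  have := Fintype.ofFinite G
  have hn : ∀ i : G, orderOf i ≠ 0 := fun i => (orderOf_pos i).ne'
  have hζ : ∀ i : G, IsPrimitiveRoot (stdRoot (orderOf i)) (orderOf i) :=
    fun i => isPrimitiveRoot_stdRoot (hn i)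
  let S : G → ℂ → (G → ℂ) →L[ℂ] (G → ℂ) :=
    fun i => eigenScale (orderOf i) (stdRoot (orderOf i)) (leftTranslation i)
  have hSmul : ∀ i s t, S i s * S i t = S i (s * t) :=
    fun i => eigenScale_mul (hζ i) (leftTranslation_pow_orderOf i)
  have hS1 : ∀ i, S i 1 = 1 := fun i => eigenScale_one (hζ i) (hn i)
  have hSd : ∀ i, Differentiable ℂ (S i) := fun i => differentiable_eigenScale _ _ _
  set δ : ℝ := 1 / (Fintype.card G + 1) with hδdef
  have hδ : 0 < δ := by positivity
  have hev : ∀ i, ∀ᶠ w : ℂ × ℂ in 𝓝 (0 : ℂ × ℂ),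
      ‖S i (mobiusRoot (orderOf i) w.1 * (mobiusRoot (orderOf i) w.2)⁻¹) - 1‖ < δ := by
    intro i
    have hcont : ContinuousAt (mobiusRoot (orderOf i)) 0 :=
      (differentiableAt_mobiusRoot _ (by simp)).continuousAt
    have h1 : ContinuousAt (fun w : ℂ × ℂ =>
        ‖S i (mobiusRoot (orderOf i) w.1 * (mobiusRoot (orderOf i) w.2)⁻¹) - 1‖) 0 := by
      refine ContinuousAt.norm (ContinuousAt.sub ?_ continuousAt_const)
      refine (hSd i).continuous.continuousAt.comp (ContinuousAt.mul ?_ (ContinuousAt.inv₀ ?_ ?_))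
      · exact hcont.comp_of_eq continuousAt_fst rfl
      · exact hcont.comp_of_eq continuousAt_snd rfl
      · exact mobiusRoot_ne_zero _ (by simp)
    refine h1.eventually_lt continuousAt_const ?_
    simpa [mobiusRoot_zero, hS1] using hδ
  obtain ⟨η, hη, hη'⟩ := Metric.eventually_nhds_iff.1 (eventually_all.2 hev)
  set ε : ℝ := min (η / 2) (1 / 4) with hεdef
  have hε : 0 < ε := by positivity
  have hε1 : ε < 1 / 2 := (min_le_right _ _).trans_lt (by norm_num)
  have hεη : ε < η := (min_le_left _ _).trans_lt (by linarith)
  refine ⟨ε, hε, hε1, fun v => ?_⟩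
  let ξ : G → ℂ → ℂ := fun i => branchRoot (c i) ε (orderOf i)
  have hout : ∀ i z, z ∈ (closedBall (c i : ℂ) (1 / 2))ᶜ → ε < dist z (c i) := by
    intro i z hz
    rw [mem_compl_iff, mem_closedBall, not_le] at hz
    linarith
  obtain ⟨f, k, hf, hk, hfk, hlim⟩ := exists_patched_section (c := fun i => (c i : ℂ))
    (B := fun i z => S i (ξ i z)) (B' := fun i z => S i (ξ i z)⁻¹) (δ := δ) (v := v)
    (fun i j hij => (hc i j hij).trans_eq (isometry_ofReal.dist_eq _ _).symm)
    (fun i z hz => ((hSd i _).comp z (differentiableAt_branchRoot _ hε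
      (hout i z hz))).differentiableWithinAt)
    (fun i z hz => ((hSd i _).comp z ((differentiableAt_branchRoot _ hε
      (hout i z hz)).inv (branchRoot_ne_zero _ hε (hout i z hz)))).differentiableWithinAt)
    (fun i z hz => by
      rw [hSmul, mul_inv_cancel₀ (branchRoot_ne_zero _ hε (hout i z hz)), hS1]) hδ.le
    (fun i z ζ hz hζ' => by
      rw [hSmul]
      have hw : ∀ z, 1 ≤ dist z (c i : ℂ) → ‖(ε : ℂ) / (z - c i)‖ < η := by
        intro z hz
        rw [norm_div, norm_real, Real.norm_of_nonneg hε.le, ← dist_eq_norm]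
        exact (div_le_self hε.le hz).trans_lt hεη
      refine (hη' (y := ((ε : ℂ) / (z - c i), (ε : ℂ) / (ζ - c i))) ?_ i).le
      rw [dist_zero_right, Prod.norm_def]
      exact max_lt (hw z hz) (hw ζ hζ'.ge))
    (by
      rw [hδdef, mul_one_div, div_lt_one (by positivity)]
      linarith)
  refine ⟨fun g z => f z g, fun i j g z =>
    spectralProj (orderOf i) (stdRoot (orderOf i)) (leftTranslation i) j (k i z) g,
    fun g => ?_, fun i j g => ?_, fun i g m z hz hz1 => ?_, fun g => ?_⟩
  · exact differentiableOn_pi.1 hf g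
  · refine differentiableOn_pi.1 (DifferentiableOn.clm_apply ?_ (hk i)) g
    exact differentiableOn_const _
  · change f z (i ^ m * g) = _
    rw [← leftTranslation_pow_apply i m (f z) g, hfk i z hz hz1]
    change (leftTranslation i ^ m * S i (ξ i z)) (k i z) g = _
    simp only [S, eigenScale, Finset.mul_sum, mul_smul_comm]
    simp only [pow_mul_spectralProj (hζ i) (leftTranslation_pow_orderOf i) (hn i)]
    rw [_root_.sum_apply, Finset.sum_apply]
    refine Finset.sum_congr rfl fun j _ => ?_
    simp only [_root_.smul_apply, Pi.smul_apply, smul_eq_mul, ξ, mul_pow]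
    ring
  · exact (tendsto_pi_nhds.1 hlim) g

end Sections

section BranchRing

/-- The function `k(z) x ^ j` on the `n`-sheeted cover with coordinate `x`, restricted to `S`;
the first argument indexes the sheets. -/
noncomputable def branchMonomial (c ε : ℝ) (n : ℕ) (S : Set ℂ) (k : ℂ → ℂ) (j : ℤ)
    (p : ℕ × S) : ℂ :=
  k p.2 * (stdRoot n ^ p.1 * branchRoot c ε n p.2) ^ j

/-- The ring of functions on a cyclic cover of `S`, ramified at `c ± i ε`, generated by the
functions `k(z) x ^ j` with `k` holomorphic on the disc of radius `2` around `c`. -/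
def branchRing (c ε : ℝ) (n : ℕ) (S : Set ℂ) : Subring (ℕ × S → ℂ) :=
  Subring.closure
    {φ | ∃ k j, DifferentiableOn ℂ k (ball (c : ℂ) 2) ∧ φ = branchMonomial c ε n S k j}

variable {c ε : ℝ} {n : ℕ} {S : Set ℂ}

theorem stdRoot_pow_mul_branchRoot_ne_zero (hn : n ≠ 0) (hε : 0 < ε) {z : ℂ} (hz : ε < dist z c)
    (m : ℕ) : stdRoot n ^ m * branchRoot c ε n z ≠ 0 :=
  mul_ne_zero (pow_ne_zero _ ((isPrimitiveRoot_stdRoot hn).ne_zero hn))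
    (branchRoot_ne_zero n hε hz)

@[elab_as_elim]
theorem branchRing_induction (hn : n ≠ 0) (hε : 0 < ε) (hS : ∀ z ∈ S, ε < dist z (c : ℂ))
    {P : (ℕ × S → ℂ) → Prop}
    (hmon : ∀ k j, DifferentiableOn ℂ k (ball (c : ℂ) 2) → P (branchMonomial c ε n S k j))
    (hadd : ∀ φ ψ, P φ → P ψ → P (φ + ψ)) (hneg : ∀ φ, P φ → P (-φ))
    {φ : ℕ × S → ℂ} (hφ : φ ∈ branchRing c ε n S) : P φ := by
  have h0 : P 0 := by
    convert hmon 0 0 (differentiableOn_const 0)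
    ext p
    simp [branchMonomial]
  rw [branchRing, Subring.mem_closure_iff] at hφ
  induction hφ using AddSubgroup.closure_induction with
  | zero => exact h0
  | add x y _ _ hx hy => exact hadd x y hx hy
  | neg x _ hx => exact hneg x hx
  | mem x hx =>
    suffices h : ∃ k j, DifferentiableOn ℂ k (ball (c : ℂ) 2) ∧ x = branchMonomial c ε n S k j by
      obtain ⟨k, j, hk, rfl⟩ := h
      exact hmon k j hk
    induction hx using Submonoid.closure_induction with
    | mem x hx => exact hx
    | one =>
      refine ⟨1, 0, differentiableOn_const 1, ?_⟩
      ext p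
      simp [branchMonomial]
    | mul x y _ _ hx hy =>
      obtain ⟨k, j, hk, rfl⟩ := hx
      obtain ⟨k', j', hk', rfl⟩ := hy
      refine ⟨k * k', j + j', hk.mul hk', ?_⟩
      ext p
      have := stdRoot_pow_mul_branchRoot_ne_zero hn hε (hS _ p.2.2) p.1
      simp only [branchMonomial, Pi.mul_apply, zpow_add₀ this]
      ring

theorem stdRoot_pow_mul_branchRoot_pow (hn : n ≠ 0) (hε : 0 < ε) {z : ℂ} (hz : ε < dist z c)
    (m : ℕ) : (stdRoot n ^ m * branchRoot c ε n z) ^ n = (z - c + I * ε) / (z - c - I * ε) := by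
  rw [mul_pow, ← pow_mul, mul_comm m, pow_mul, (isPrimitiveRoot_stdRoot hn).pow_eq_one, one_pow,
    one_mul, branchRoot_pow hn hε hz]

theorem sub_I_mul_ne_zero (hε : 0 < ε) {z : ℂ} (hz : ε < dist z c) : z - c - I * ε ≠ 0 := by
  intro h
  have h1 : z - c = I * ε := by linear_combination h
  rw [dist_eq_norm, h1] at hz
  simp [abs_of_pos hε] at hz

theorem add_I_mul_ne_zero (hε : 0 < ε) {z : ℂ} (hz : ε < dist z c) : z - c + I * ε ≠ 0 := by
  intro h
  have h1 : z - c = -(I * ε) := by linear_combination h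
  rw [dist_eq_norm, h1] at hz
  simp [abs_of_pos hε] at hz

/-- The projection of the cover to the base, in terms of the coordinate on the cover. -/
noncomputable def coverProj (c ε : ℝ) (n : ℕ) (x : ℂ) : ℂ :=
  c + I * ε * ((x ^ n + 1) / (x ^ n - 1))

theorem coverProj_branch (hn : n ≠ 0) (hε : 0 < ε) {z : ℂ} (hz : ε < dist z c) (m : ℕ) :
    coverProj c ε n (stdRoot n ^ m * branchRoot c ε n z) = z := by
  have h1 := sub_I_mul_ne_zero hε hz
  have h2 : (ε : ℂ) ≠ 0 := by exact_mod_cast hε.ne'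
  rw [coverProj, stdRoot_pow_mul_branchRoot_pow hn hε hz, div_add_one h1, div_sub_one h1,
    div_div_div_cancel_right₀ h1]
  have h3 : z - c + I * ε - (z - c - I * ε) = 2 * (I * ε) := by ring
  have h4 : I * (ε : ℂ) ≠ 0 := mul_ne_zero I_ne_zero h2
  rw [h3]
  field_simp
  ring

theorem pow_ne_one_of_norm_pow_lt {r : ℝ} (hr : r ≤ 1) {x : ℂ} (hx : ‖x‖ ^ n < r) :
    x ^ n - 1 ≠ 0 := by
  intro h
  have h1 := congrArg norm (sub_eq_zero.1 h)
  rw [norm_pow, norm_one] at h1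
  linarith

theorem coverProj_mem_ball (hε : 0 < ε) {x : ℂ} (hx : ‖x‖ ^ n < (2 - ε) / (2 + ε)) :
    coverProj c ε n x ∈ ball (c : ℂ) 2 := by
  have hr : (2 - ε) / (2 + ε) ≤ 1 := by rw [div_le_one] <;> linarith
  have h0 := pow_ne_one_of_norm_pow_lt hr hx
  rw [mem_ball, dist_eq_norm, coverProj, add_sub_cancel_left, norm_mul, norm_div, norm_mul, norm_I,
    one_mul, norm_real, Real.norm_of_nonneg hε.le, ← mul_div_assoc, div_lt_iff₀ (norm_pos_iff.2 h0)]
  have h1 : ‖x ^ n + 1‖ ≤ ‖x‖ ^ n + 1 := by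
    simpa using norm_add_le (x ^ n) 1
  have h2 : 1 - ‖x‖ ^ n ≤ ‖x ^ n - 1‖ := by
    have := norm_sub_norm_le 1 (x ^ n)
    rw [norm_sub_rev] at this
    simpa using this
  rw [lt_div_iff₀ (by linarith)] at hx
  nlinarith

theorem differentiableAt_coverProj {x : ℂ} (hx : x ^ n - 1 ≠ 0) :
    DifferentiableAt ℂ (coverProj c ε n) x := by
  unfold coverProj
  fun_prop (disch := assumption)

theorem branchRing_exists_holomorphic (hn : n ≠ 0) (hε : 0 < ε)
    (hS : ∀ z ∈ S, ε < dist z (c : ℂ)) {φ : ℕ × S → ℂ} (hφ : φ ∈ branchRing c ε n S) :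
    ∃ (N : ℕ) (Φ : ℂ → ℂ), DifferentiableOn ℂ Φ {x | ‖x‖ ^ n < (2 - ε) / (2 + ε)} ∧
      ∀ p : ℕ × S, (stdRoot n ^ p.1 * branchRoot c ε n p.2) ^ N * φ p
        = Φ (stdRoot n ^ p.1 * branchRoot c ε n p.2) := by
  refine branchRing_induction hn hε hS (fun k j hk => ?_) (fun φ ψ h h' => ?_) (fun φ h => ?_) hφ
  · have hr : (2 - ε) / (2 + ε) ≤ 1 := by rw [div_le_one] <;> linarith
    refine ⟨j.natAbs, fun x => x ^ (j.natAbs + j).toNat * k (coverProj c ε n x), ?_, fun p => ?_⟩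
    · refine DifferentiableOn.mul (by fun_prop) (hk.comp (fun x hx => ?_)
        fun x hx => coverProj_mem_ball hε hx)
      exact (differentiableAt_coverProj
        (pow_ne_one_of_norm_pow_lt hr hx)).differentiableWithinAt
    · have h0 := stdRoot_pow_mul_branchRoot_ne_zero hn hε (hS _ p.2.2) p.1
      simp only [coverProj_branch hn hε (hS _ p.2.2), branchMonomial]
      rw [← zpow_natCast _ (j.natAbs + j).toNat, Int.toNat_of_nonneg (by lia), zpow_add₀ h0,
        zpow_natCast]
      ring
  · obtain ⟨N, Φ, hΦ, hN⟩ := h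
    obtain ⟨N', Φ', hΦ', hN'⟩ := h'
    refine ⟨N + N', fun x => x ^ N' * Φ x + x ^ N * Φ' x, ?_, fun p => ?_⟩
    · exact (DifferentiableOn.mul (by fun_prop) hΦ).add (DifferentiableOn.mul (by fun_prop) hΦ')
    · simp only [Pi.add_apply, ← hN, ← hN']
      ring
  · obtain ⟨N, Φ, hΦ, hN⟩ := h
    exact ⟨N, fun x => -Φ x, hΦ.neg, fun p => by simp [← hN]⟩

theorem branchRing_exists_sum_extension (hn : n ≠ 0) (hε : 0 < ε)
    (hS : ∀ z ∈ S, ε < dist z (c : ℂ)) {φ : ℕ × S → ℂ} (hφ : φ ∈ branchRing c ε n S) :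
    ∃ (N : ℕ) (h : ℂ → ℂ), DifferentiableOn ℂ h (ball (c : ℂ) 2) ∧
      ∀ z : S, (((z : ℂ) - c) ^ 2 + ε ^ 2) ^ N * ∑ m ∈ Finset.range n, φ (m, z) = h z := by
  refine branchRing_induction hn hε hS (fun k j hk => ?_) (fun φ ψ h h' => ?_) (fun φ h => ?_) hφ
  · have hsum : ∀ z : S, ∑ m ∈ Finset.range n, branchMonomial c ε n S k j (m, z)
        = k z * branchRoot c ε n z ^ j * ∑ m ∈ Finset.range n, (stdRoot n ^ j) ^ m := by
      intro z
      rw [Finset.mul_sum]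
      refine Finset.sum_congr rfl fun m _ => ?_
      rw [branchMonomial, mul_zpow, ← zpow_natCast (stdRoot n ^ j), ← zpow_mul, mul_comm j,
        zpow_mul, zpow_natCast]
      ring
    have hprim := isPrimitiveRoot_stdRoot hn
    by_cases hj : (n : ℤ) ∣ j
    · obtain ⟨l, rfl⟩ := hj
      refine ⟨l.natAbs, fun z => n * k z * ((z - c + I * ε) ^ (l.natAbs + l).toNat
        * (z - c - I * ε) ^ (l.natAbs - l).toNat), by fun_prop, fun z => ?_⟩
      have hz := hS z z.2
      have h1 := sub_I_mul_ne_zero hε hz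
      have h2 := add_I_mul_ne_zero hε hz
      have h3 : stdRoot n ^ ((n : ℤ) * l) = 1 := by
        rw [zpow_mul, zpow_natCast, hprim.pow_eq_one, one_zpow]
      beta_reduce
      rw [hsum, h3, zpow_mul, zpow_natCast, branchRoot_pow hn hε hz,
        ← zpow_natCast _ (l.natAbs + l).toNat, Int.toNat_of_nonneg (by lia), zpow_add₀ h2,
        ← zpow_natCast _ (l.natAbs - l).toNat, Int.toNat_of_nonneg (by lia), zpow_sub₀ h1,
        div_zpow, zpow_natCast, zpow_natCast]
      have h4 : ((z : ℂ) - c) ^ 2 + ε ^ 2 = (z - c + I * ε) * (z - c - I * ε) := by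
        linear_combination (ε : ℂ) ^ 2 * I_sq
      rw [h4, mul_pow]
      simp only [one_pow, Finset.sum_const, Finset.card_range, nsmul_eq_mul, mul_one]
      ring
    · refine ⟨0, 0, differentiableOn_const 0, fun z => ?_⟩
      have h1 : stdRoot n ^ j ≠ 1 := fun h => hj ((hprim.zpow_eq_one_iff_dvd j).1 h)
      have h2 : (stdRoot n ^ j) ^ n = 1 := by
        rw [← zpow_natCast, ← zpow_mul, mul_comm, zpow_mul, zpow_natCast, hprim.pow_eq_one,
          one_zpow]
      rw [hsum, geom_sum_eq h1, h2]
      simp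
  · obtain ⟨N, Φ, hΦ, hN⟩ := h
    obtain ⟨N', Φ', hΦ', hN'⟩ := h'
    refine ⟨N + N', fun x => ((x - c) ^ 2 + ε ^ 2) ^ N' * Φ x + ((x - c) ^ 2 + ε ^ 2) ^ N * Φ' x,
      by fun_prop, fun p => ?_⟩
    simp only [Pi.add_apply, ← hN, ← hN', Finset.sum_add_distrib]
    ring
  · obtain ⟨N, Φ, hΦ, hN⟩ := h
    exact ⟨N, fun x => -Φ x, hΦ.neg, fun p => by simp [← hN]⟩

end BranchRing

section BranchVanishing

variable {c ε : ℝ} {n : ℕ} {S : Set ℂ}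

theorem branchRoot_coverProj (hn : n ≠ 0) (hε : 0 < ε) {x : ℂ} (hx : x ^ n - 1 ≠ 0)
    (hx' : coverProj c ε n x ≠ c) (harg : |x.arg| < Real.pi / n) :
    branchRoot c ε n (coverProj c ε n x) = x := by
  have hε' : (ε : ℂ) ≠ 0 := by exact_mod_cast hε.ne'
  have h0 : coverProj c ε n x - c ≠ 0 := sub_ne_zero.2 hx'
  have h1 : (1 + I * (ε / (coverProj c ε n x - c))) / (1 - I * (ε / (coverProj c ε n x - c)))
      = x ^ n := by
    rw [← mul_div_mul_right _ _ h0]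
    have h2 : (1 + I * (ε / (coverProj c ε n x - c))) * (coverProj c ε n x - c)
        = I * ε * (2 * x ^ n / (x ^ n - 1)) := by
      rw [add_mul, mul_assoc, div_mul_cancel₀ _ h0, coverProj]
      field_simp
      ring
    have h3 : (1 - I * (ε / (coverProj c ε n x - c))) * (coverProj c ε n x - c)
        = I * ε * (2 / (x ^ n - 1)) := by
      rw [sub_mul, mul_assoc, div_mul_cancel₀ _ h0, coverProj]
      field_simp
      ring
    rw [h2, h3]
    have := I_ne_zero
    field_simp
  rw [branchRoot, mobiusRoot, h1]
  rw [abs_lt] at harg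
  exact pow_cpow_nat_inv hn harg.1 harg.2.le

theorem branchRing_eq_zero (hn : n ≠ 0) (hε : 0 < ε) (hε1 : ε < 1)
    (hS : ∀ z ∈ S, ε < dist z (c : ℂ)) (hS' : ∀ z : ℂ, 1 < dist z c → dist z c < 2 → z ∈ S)
    {φ : ℕ × S → ℂ} (hφ : φ ∈ branchRing c ε n S) (h0 : ∀ z, φ (0, z) = 0) (m : ℕ) (z : S)
    (hz : ‖branchRoot c ε n z‖ ^ n < (2 - ε) / (2 + ε)) : φ (m, z) = 0 := by
  obtain ⟨N, Φ, hΦ, hN⟩ := branchRing_exists_holomorphic hn hε hS hφ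
  set W : Set ℂ := {x | ‖x‖ ^ n < (2 - ε) / (2 + ε)} with hW
  have hr0 : 0 < (2 - ε) / (2 + ε) := div_pos (by linarith) (by linarith)
  have hr1 : (2 - ε) / (2 + ε) ≤ 1 := by rw [div_le_one] <;> linarith
  have hWball : W = ball 0 (((2 - ε) / (2 + ε)) ^ ((n : ℝ)⁻¹)) := by
    ext x
    rw [hW, mem_ofPred_eq, mem_ball_zero_iff,
      ← pow_lt_pow_iff_left₀ (norm_nonneg x) (by positivity) hn,
      Real.rpow_inv_natCast_pow hr0.le hn]
  have hWo : IsOpen W := by rw [hWball]; exact isOpen_ball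
  have hWc : IsPreconnected W := by rw [hWball]; exact (convex_ball _ _).isPreconnected
  set a : ℝ := (3 / 2 - ε) / (3 / 2 + ε) with ha
  have ha0 : 0 < a := div_pos (by linarith) (by linarith)
  set b : ℝ := a ^ ((n : ℝ)⁻¹) with hb
  have hb0 : 0 < b := by positivity
  have hbn : b ^ n = a := Real.rpow_inv_natCast_pow ha0.le hn
  have hbW : (b : ℂ) ∈ W := by
    rw [hW, mem_ofPred_eq, norm_real, Real.norm_of_nonneg hb0.le, hbn, ha,
      div_lt_div_iff₀ (by linarith) (by linarith)]
    nlinarith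
  have hproj : coverProj c ε n b = c - 3 / 2 * I := by
    have h1 : (3 / 2 + ε : ℂ) ≠ 0 := by
      have : ((3 / 2 + ε : ℝ) : ℂ) ≠ 0 := ofReal_ne_zero.2 (by linarith)
      simpa using this
    have hε' : (ε : ℂ) ≠ 0 := by exact_mod_cast hε.ne'
    have h2 : (b : ℂ) ^ n = (3 / 2 - ε) / (3 / 2 + ε) := by
      rw [← ofReal_pow, hbn, ha]
      push_cast
      rfl
    rw [coverProj, h2, div_add_one h1, div_sub_one h1, div_div_div_cancel_right₀ h1]
    have h3 : (3 / 2 - ε - (3 / 2 + ε) : ℂ) = -2 * ε := by ring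
    rw [h3]
    field_simp
    ring
  have hpcont : ContinuousAt (coverProj c ε n) b :=
    (differentiableAt_coverProj (pow_ne_one_of_norm_pow_lt hr1 hbW)).continuousAt
  have hdist : dist (coverProj c ε n b) c = 3 / 2 := by
    rw [hproj, dist_eq_norm]
    simp
  have hdcont : ContinuousAt (fun x => dist (coverProj c ε n x) c) b :=
    hpcont.dist continuousAt_const
  have harg : ContinuousAt (fun x => |arg x|) (b : ℂ) :=
    (continuousAt_arg (ofReal_mem_slitPlane.2 hb0)).abs
  have hev : Φ =ᶠ[𝓝 (b : ℂ)] 0 := by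
    filter_upwards [hWo.mem_nhds hbW,
      hdcont.eventually_const_lt (show 1 < dist (coverProj c ε n b) c by rw [hdist]; norm_num),
      hdcont.eventually_lt_const (show dist (coverProj c ε n b) c < 2 by rw [hdist]; norm_num),
      harg.eventually_lt_const (show |arg b| < Real.pi / n by
        rw [arg_ofReal_of_nonneg hb0.le, abs_zero]; positivity)] with x hxW hx1 hx2 hx3
    have hxc : coverProj c ε n x ≠ c := dist_pos.1 (one_pos.trans hx1)
    have h1 := hN (0, ⟨_, hS' _ hx1 hx2⟩)
    rw [h0, mul_zero, pow_zero, one_mul,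
      branchRoot_coverProj hn hε (pow_ne_one_of_norm_pow_lt hr1 hxW) hxc hx3] at h1
    exact h1.symm
  have hzero : EqOn Φ 0 W := (hΦ.analyticOnNhd hWo).eqOn_zero_of_preconnected_of_eventuallyEq_zero
    hWc hbW hev
  have hx : stdRoot n ^ m * branchRoot c ε n z ∈ W := by
    rw [hW, mem_ofPred_eq, norm_mul, norm_pow, (isPrimitiveRoot_stdRoot hn).norm'_eq_one hn,
      one_pow,
      one_mul]
    exact hz
  have h1 := hN (m, z)
  rw [hzero hx, Pi.zero_apply, mul_eq_zero] at h1
  exact h1.resolve_left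
    (pow_ne_zero _ (stdRoot_pow_mul_branchRoot_ne_zero hn hε (hS _ z.2) m))

theorem eventually_norm_branchRoot_lt (hn : n ≠ 0) (hε : 0 < ε) (hε1 : ε < 1) :
    ∀ᶠ z in 𝓝 (c - 3 / 2 * I : ℂ), ‖branchRoot c ε n z‖ ^ n < (2 - ε) / (2 + ε) := by
  have hd : ε < dist (c - 3 / 2 * I : ℂ) c := by
    rw [dist_eq_norm]
    simp
    linarith
  refine ((differentiableAt_branchRoot n hε hd).continuousAt.norm.pow n).eventually_lt_const ?_
  have h1 : (c - 3 / 2 * I - c + I * ε : ℂ) = ((3 / 2 - ε : ℝ) : ℂ) * -I := by push_cast; ring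
  have h2 : (c - 3 / 2 * I - c - I * ε : ℂ) = ((3 / 2 + ε : ℝ) : ℂ) * -I := by push_cast; ring
  simp only [Pi.pow_apply]
  rw [← norm_pow, branchRoot_pow hn hε hd, h1, h2, norm_div, norm_mul, norm_mul, norm_neg, norm_I,
    mul_one, mul_one, norm_real, norm_real, Real.norm_of_nonneg (by linarith),
    Real.norm_of_nonneg (by linarith), div_lt_div_iff₀ (by linarith) (by linarith)]
  nlinarith

end BranchVanishing

section PolynomialGrowth

open Polynomial Asymptotics

theorem isBigO_cobounded_const {C : ℂ} (N : ℕ) :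
    (fun _ : ℂ => C) =O[Bornology.cobounded ℂ] fun z => z ^ N := by
  refine IsBigO.of_bound ‖C‖ ?_
  filter_upwards [tendsto_norm_cobounded_atTop.eventually_ge_atTop 1] with z hz
  rw [norm_pow]
  exact le_mul_of_one_le_right (norm_nonneg _) (one_le_pow₀ hz)

theorem isBigO_cobounded_pow {N M : ℕ} (h : N ≤ M) :
    (fun z : ℂ => z ^ N) =O[Bornology.cobounded ℂ] fun z => z ^ M := by
  refine IsBigO.of_bound 1 ?_
  filter_upwards [tendsto_norm_cobounded_atTop.eventually_ge_atTop 1] with z hz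
  rw [norm_pow, norm_pow, one_mul]
  exact pow_le_pow_right₀ hz h

/-- An entire function of polynomial growth is a polynomial. -/
theorem exists_polynomial_of_isBigO {H : ℂ → ℂ} (hH : Differentiable ℂ H) {N : ℕ}
    (hN : H =O[Bornology.cobounded ℂ] fun z => z ^ N) : ∃ p : ℂ[X], ∀ z, H z = p.eval z := by
  induction N generalizing H with
  | zero =>
    obtain ⟨C, hC⟩ := hN.bound
    obtain ⟨R, -, hR⟩ := (hasBasis_cobounded_norm (E := ℂ)).mem_iff.1 hC
    obtain ⟨C', hC'⟩ := (isCompact_closedBall (0 : ℂ) R).exists_bound_of_continuousOn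
      hH.continuous.continuousOn
    have hb : Bornology.IsBounded (range H) := by
      refine isBounded_iff_forall_norm_le.2 ⟨max C C', ?_⟩
      rintro _ ⟨z, rfl⟩
      rcases le_total R ‖z‖ with h | h
      · have := hR h
        simp only [mem_ofPred_eq, pow_zero, norm_one, mul_one] at this
        exact this.trans (le_max_left _ _)
      · exact (hC' z (mem_closedBall_zero_iff.2 h)).trans (le_max_right _ _)
    exact ⟨Polynomial.C (H 0), fun z => by rw [eval_C, hH.apply_eq_apply_of_bounded hb z 0]⟩
  | succ N ih =>
    have hd : Differentiable ℂ (dslope H 0) := by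
      rw [← differentiableOn_univ, differentiableOn_dslope univ_mem, differentiableOn_univ]
      exact hH
    have hO : dslope H 0 =O[Bornology.cobounded ℂ] fun z => z ^ N := by
      have h1 : (fun z => z⁻¹ * (H z - H 0)) =O[Bornology.cobounded ℂ]
          fun z => z⁻¹ * z ^ (N + 1) :=
        (isBigO_refl _ _).mul (hN.sub (isBigO_cobounded_const _))
      refine h1.congr' ?_ ?_ <;>
      filter_upwards [Bornology.eventually_ne_cobounded (0 : ℂ)] with z hz
      · rw [dslope_of_ne _ hz, slope_def_field, sub_zero]
        field_simp
      · rw [pow_succ', inv_mul_cancel_left₀ hz]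
    obtain ⟨p, hp⟩ := ih hd hO
    refine ⟨Polynomial.C (H 0) + X * p, fun z => ?_⟩
    have := sub_smul_dslope H 0 z
    rw [sub_zero, hp, smul_eq_mul] at this
    simp [this]

/-- A complex polynomial taking real values at infinitely many real points is real. -/
theorem exists_real_polynomial {p : ℂ[X]} {T : Set ℝ} (hT : T.Infinite)
    (h : ∀ x ∈ T, (p.eval (x : ℂ)).im = 0) : ∃ q : ℝ[X], p = q.map ofRealHom := by
  let q : ℝ[X] := ∑ i ∈ Finset.range (p.natDegree + 1), Polynomial.C (p.coeff i).re * X ^ i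
  have hq : ∀ x : ℝ, q.eval x = (p.eval (x : ℂ)).re := by
    intro x
    rw [eval_eq_sum_range (p := p), re_sum, eval_finsetSum]
    refine Finset.sum_congr rfl fun i _ => ?_
    rw [← ofReal_pow, re_mul_ofReal]
    simp
  refine ⟨q, eq_of_infinite_eval_eq _ _ ((hT.image ofReal_injective.injOn).mono ?_)⟩
  rintro _ ⟨x, hx, rfl⟩
  rw [mem_ofPred_eq, ← ofRealHom_eq_coe, eval_map_apply, hq]
  simp only [ofRealHom_eq_coe]
  exact Complex.ext rfl (by simpa using h x hx)

end PolynomialGrowth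

section OuterRegion

variable {G : Type*} {c : G → ℝ} {z : ℂ}

theorem conj_mem_outerRegion (hz : z ∈ outerRegion c) : starRingEnd ℂ z ∈ outerRegion c := by
  intro i
  rw [← conj_ofReal, dist_conj_conj]
  exact hz i

variable [Finite G]

theorem isOpen_outerRegion : IsOpen (outerRegion c) := by
  have : outerRegion c = ⋂ i, {z : ℂ | 1 < dist z (c i)} := by
    ext z
    simp [outerRegion]
  rw [this]
  exact isOpen_iInter_of_finite fun i => isOpen_lt continuous_const (by fun_prop)

theorem exists_forall_ge_mem_outerRegion (c : G → ℝ) :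
    ∃ R : ℝ, ∀ w : ℂ, R ≤ w.re → w ∈ outerRegion c := by
  obtain ⟨M, hM⟩ := (Set.finite_range c).bddAbove
  refine ⟨M + 2, fun w hw i => ?_⟩
  have h1 : c i ≤ M := hM ⟨i, rfl⟩
  have h2 : |(w - c i).re| ≤ dist w (c i) := dist_eq_norm w _ ▸ abs_re_le_norm _
  have h3 := le_abs_self (w - c i).re
  simp only [sub_re, ofReal_re] at h2 h3
  linarith

theorem isPreconnected_outerRegion : IsPreconnected (outerRegion c) := by
  obtain ⟨R, hR⟩ := exists_forall_ge_mem_outerRegion c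
  have key : ∀ y ∈ outerRegion c, 0 ≤ y.im →
      ∃ t ⊆ outerRegion c, (R : ℂ) ∈ t ∧ y ∈ t ∧ IsPreconnected t := by
    intro y hy hy0
    let ray : Set ℂ := (fun s : ℝ => y + s * I) '' Ici 0
    let half : Set ℂ := {w | 1 < w.im}
    let line : Set ℂ := (fun s : ℝ => (R : ℂ) + s * I) '' univ
    have hray : IsPreconnected ray := isPreconnected_Ici.image _ (by fun_prop)
    have hline : IsPreconnected line := isPreconnected_univ.image _ (by fun_prop)
    have hhalf : IsPreconnected half := (convex_halfSpace_im_gt 1).isPreconnected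
    refine ⟨ray ∪ half ∪ line, ?_, Or.inr ⟨0, mem_univ _, by simp⟩,
      Or.inl (Or.inl ⟨0, self_mem_Ici, by simp⟩), ?_⟩
    · refine union_subset (union_subset ?_ ?_) ?_
      · rintro _ ⟨s, hs, rfl⟩ i
        refine (hy i).trans_le ?_
        have hs' : 0 ≤ s := hs
        rw [Complex.dist_eq_re_im, Complex.dist_eq_re_im]
        refine Real.sqrt_le_sqrt ?_
        simp
        nlinarith
      · intro w hw i
        have h2 : |(w - c i).im| ≤ dist w (c i) := dist_eq_norm w _ ▸ abs_im_le_norm _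
        have h3 := le_abs_self (w - c i).im
        have h4 : 1 < w.im := hw
        simp only [sub_im, ofReal_im] at h2 h3
        linarith
      · rintro _ ⟨s, -, rfl⟩
        exact hR _ (by simp)
    · refine IsPreconnected.union ((R : ℂ) + (2 : ℝ) * I) (Or.inr ?_) ⟨2, mem_univ _, rfl⟩
        (IsPreconnected.union (y + (2 : ℝ) * I) ⟨2, by simp, rfl⟩ ?_ hray hhalf) hline
      · simp [half]
      · simp only [half, mem_ofPred_eq]
        simp
        linarith
  refine isPreconnected_of_forall (R : ℂ) fun y hy => ?_
  rcases le_total 0 y.im with h | h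
  · exact key y hy h
  · obtain ⟨t, ht, hRt, hyt, hct⟩ := key _ (conj_mem_outerRegion hy) (by simpa using h)
    refine ⟨starRingEnd ℂ '' t, ?_, ⟨R, hRt, conj_ofReal R⟩, ⟨_, hyt, conj_conj y⟩,
      hct.image _ continuous_conj.continuousOn⟩
    rintro _ ⟨w, hw, rfl⟩
    exact conj_mem_outerRegion (ht hw)

/-- A holomorphic function on the outer region vanishing at all large reals is zero. -/
theorem eqOn_zero_of_real {F : ℂ → ℂ} (hF : DifferentiableOn ℂ F (outerRegion c)) {R : ℝ}
    (h : ∀ x : ℝ, R ≤ x → F x = 0) : EqOn F 0 (outerRegion c) := by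
  obtain ⟨R', hR'⟩ := exists_forall_ge_mem_outerRegion c
  set x₀ : ℝ := max R R' + 1 with hx₀
  refine (hF.analyticOnNhd isOpen_outerRegion).eqOn_zero_of_preconnected_of_frequently_eq_zero
    isPreconnected_outerRegion (z₀ := (x₀ : ℂ)) (hR' _ ?_) ?_
  · rw [ofReal_re, hx₀]
    linarith [le_max_right R R']
  · have h1 : ∃ᶠ x : ℝ in 𝓝[≠] x₀, F x = 0 := by
      refine Eventually.frequently (eventually_nhdsWithin_of_eventually_nhds ?_)
      have : R < x₀ := by linarith [le_max_left R R']
      filter_upwards [lt_mem_nhds this] with x hx using h x hx.le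
    have h2 : Tendsto ofReal (𝓝[≠] x₀) (𝓝[≠] (x₀ : ℂ)) :=
      continuous_ofReal.continuousWithinAt.tendsto_nhdsWithin
        fun x hx => by simpa using hx
    exact h2.frequently h1

end OuterRegion

section CoverRing

open Polynomial Asymptotics

variable {G : Type*}

/-- Holomorphic functions of polynomial growth on the outer region, compatible with complex
conjugation. -/
def regularFun (c : G → ℝ) : Subring (outerRegion c → ℂ) where
  carrier := {f | ∃ F : ℂ → ℂ, DifferentiableOn ℂ F (outerRegion c) ∧
    (∃ N : ℕ, F =O[Bornology.cobounded ℂ] fun z => z ^ N) ∧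
    (∀ z ∈ outerRegion c, F (starRingEnd ℂ z) = starRingEnd ℂ (F z)) ∧ ∀ z, f z = F z}
  zero_mem' := ⟨0, differentiableOn_const 0, ⟨0, isBigO_zero _ _⟩, by simp, fun _ => rfl⟩
  one_mem' := ⟨1, differentiableOn_const 1, ⟨0, isBigO_cobounded_const 0⟩, by simp, fun _ => rfl⟩
  add_mem' := by
    rintro f f' ⟨F, h1, ⟨N, hN⟩, h3, h4⟩ ⟨F', h1', ⟨N', hN'⟩, h3', h4'⟩
    refine ⟨F + F', h1.add h1', ⟨max N N', ?_⟩, fun z hz => ?_, fun z => ?_⟩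
    · exact (hN.trans (isBigO_cobounded_pow (le_max_left _ _))).add
        (hN'.trans (isBigO_cobounded_pow (le_max_right _ _)))
    · simp [h3 z hz, h3' z hz]
    · simp [h4, h4']
  neg_mem' := by
    rintro f ⟨F, h1, ⟨N, hN⟩, h3, h4⟩
    exact ⟨-F, h1.neg, ⟨N, hN.neg_left⟩, fun z hz => by simp [h3 z hz], fun z => by simp [h4]⟩
  mul_mem' := by
    rintro f f' ⟨F, h1, ⟨N, hN⟩, h3, h4⟩ ⟨F', h1', ⟨N', hN'⟩, h3', h4'⟩
    refine ⟨F * F', h1.mul h1', ⟨N + N', ?_⟩, fun z hz => ?_, fun z => ?_⟩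
    · exact (hN.mul hN').congr_right fun z => (pow_add z N N').symm
    · simp [h3 z hz, h3' z hz]
    · simp [h4, h4']

/-- The part of the outer region close to `c i`. -/
def nearRegion (c : G → ℝ) (i : G) : Set ℂ := {z | z ∈ outerRegion c ∧ dist z (c i) < 2}

theorem lt_dist_of_mem_nearRegion {c : G → ℝ} {ε : ℝ} (hε : ε < 1) (i : G) :
    ∀ z ∈ nearRegion c i, ε < dist z (c i) :=
  fun _ hz => hε.trans (hz.1 i)

theorem mem_nearRegion {c : G → ℝ} (hc : ∀ i j, i ≠ j → 4 ≤ dist (c i) (c j)) (i : G) (z : ℂ)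
    (h1 : 1 < dist z (c i)) (h2 : dist z (c i) < 2) : z ∈ nearRegion c i := by
  refine ⟨fun j => ?_, h2⟩
  by_cases hij : i = j
  · exact hij ▸ h1
  · have h3 := hc i j hij
    rw [← isometry_ofReal.dist_eq] at h3
    have h4 := dist_triangle (c i : ℂ) z (c j)
    rw [dist_comm (c i : ℂ) z] at h4
    linarith

theorem isBigO_aeval (p : ℝ[X]) :
    ∃ N : ℕ, (fun z : ℂ => aeval z p) =O[Bornology.cobounded ℂ] fun z => z ^ N := by
  induction p using Polynomial.induction_on' with
  | add p q hp hq =>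
    obtain ⟨N, hN⟩ := hp
    obtain ⟨N', hN'⟩ := hq
    refine ⟨max N N', ?_⟩
    simp only [map_add]
    exact (hN.trans (isBigO_cobounded_pow (le_max_left _ _))).add
        (hN'.trans (isBigO_cobounded_pow (le_max_right _ _)))
  | monomial n a =>
    refine ⟨n, ?_⟩
    simp only [aeval_monomial]
    exact isBigO_const_mul_self _ _ _


theorem eqOn_zero_of_eventually [Finite G] {c : G → ℝ} {F : ℂ → ℂ}
    (hF : DifferentiableOn ℂ F (outerRegion c)) {z : ℂ}
    (hz : z ∈ outerRegion c) (h : ∀ᶠ w in 𝓝 z, F w = 0) : EqOn F 0 (outerRegion c) :=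
  (hF.analyticOnNhd isOpen_outerRegion).eqOn_zero_of_preconnected_of_eventuallyEq_zero
    isPreconnected_outerRegion hz h

variable [Group G]

/-- Restriction of a `G`-indexed family of functions to the sheets `i ^ m * g` near `c i`. -/
def sheets (c : G → ℝ) (i g : G) :
    (G → outerRegion c → ℂ) →+* (ℕ × nearRegion c i → ℂ) :=
  RingHom.pi fun p => (Pi.evalRingHom (fun _ : outerRegion c => ℂ) ⟨p.2, p.2.2.1⟩).comp
    (Pi.evalRingHom (fun _ : G => outerRegion c → ℂ) (i ^ p.1 * g))

theorem sheets_apply (c : G → ℝ) (i g : G) (f : G → outerRegion c → ℂ)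
    (p : ℕ × nearRegion c i) : sheets c i g f p = f (i ^ p.1 * g) ⟨p.2, p.2.2.1⟩ := rfl

/-- Functions on a Galois cover of the line with group `G`, trivial over the outer region, whose
monodromy around `c i + i ε` is translation by `i`. -/
noncomputable def coverRing (c : G → ℝ) (ε : ℝ) : Subring (G → outerRegion c → ℂ) :=
  (⨅ g, (regularFun c).comap (Pi.evalRingHom _ g)) ⊓
    ⨅ i, ⨅ g, (branchRing (c i) ε (orderOf i) (nearRegion c i)).comap (sheets c i g)

variable {c : G → ℝ} {ε : ℝ}

theorem mem_coverRing {f : G → outerRegion c → ℂ} : f ∈ coverRing c ε ↔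
    (∀ g, f g ∈ regularFun c) ∧
      ∀ i g, sheets c i g f ∈ branchRing (c i) ε (orderOf i) (nearRegion c i) := by
  simp [coverRing, Subring.mem_inf, Subring.mem_iInf]

/-- The action of `G` on the cover ring by right translations. -/
noncomputable instance coverRingAction : MulSemiringAction G (coverRing c ε) where
  smul h f := ⟨fun g => f.1 (g * h), mem_coverRing.2 ⟨fun g => (mem_coverRing.1 f.2).1 (g * h),
    fun i g => by
      convert (mem_coverRing.1 f.2).2 i (g * h) using 1
      ext p
      simp only [sheets_apply, mul_assoc]⟩⟩
  one_smul f := Subtype.ext (funext fun g => congrArg f.1 (mul_one g))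
  mul_smul h h' f := Subtype.ext (funext fun g => congrArg f.1 (mul_assoc g h h').symm)
  smul_zero _ := rfl
  smul_add _ _ _ := rfl
  smul_one _ := rfl
  smul_mul _ _ _ := rfl

theorem coverRing_smul_apply (h : G) (f : coverRing c ε) (g : G) : (h • f).1 g = f.1 (g * h) := rfl

/-- Real polynomials in the coordinate of the base, as functions on the cover. -/
noncomputable def coverPolynomial (c : G → ℝ) (ε : ℝ) : ℝ[X] →+* coverRing c ε :=
  RingHom.codRestrict
    (RingHom.pi fun _ : G => RingHom.pi fun z : outerRegion c =>
      (aeval (z : ℂ) : ℝ[X] →ₐ[ℝ] ℂ).toRingHom)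
    (coverRing c ε) fun p => mem_coverRing.2 ⟨fun g => ⟨fun z => aeval z p,
      p.differentiable_aeval.differentiableOn, isBigO_aeval p,
      fun z _ => aeval_conj p z, fun _ => rfl⟩, fun i g => Subring.subset_closure
        ⟨fun z => aeval z p, 0, p.differentiable_aeval.differentiableOn, by
          ext
          simp [branchMonomial, sheets_apply]⟩⟩

section Finite

variable [Finite G]

theorem coverPolynomial_injective : Function.Injective (coverPolynomial c ε) := by
  rw [injective_iff_map_eq_zero]
  intro p hp
  obtain ⟨R, hR⟩ := exists_forall_ge_mem_outerRegion c
  refine eq_zero_of_infinite_isRoot p ((Ici_infinite R).mono fun x hx => ?_)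
  have h : aeval (x : ℂ) p = 0 := congrArg (fun f => f.1 1 ⟨x, hR x hx⟩) hp
  have h' : ((p.eval x : ℝ) : ℂ) = 0 := by
    rw [← h]
    exact (aeval_ofReal p x).symm
  exact_mod_cast h'

theorem eq_zero_of_apply_one (hε : 0 < ε) (hε1 : ε < 1)
    (hc : ∀ i j, i ≠ j → 4 ≤ dist (c i) (c j)) {f : coverRing c ε} (hf : f.1 1 = 0) : f = 0 := by
  refine Subtype.ext (funext fun i => funext fun z => ?_)
  obtain ⟨F, hF, -, -, hfF⟩ := (mem_coverRing.1 f.2).1 i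
  have hn : orderOf i ≠ 0 := (orderOf_pos i).ne'
  have hnear := mem_nearRegion hc i
  have h0 := branchRing_eq_zero hn hε hε1 (lt_dist_of_mem_nearRegion hε1 i) hnear
    ((mem_coverRing.1 f.2).2 i 1) (fun w => by simp [sheets_apply, hf]) 1
  have hdist : dist (c i - 3 / 2 * I : ℂ) (c i) = 3 / 2 := by
    rw [dist_eq_norm]
    simp
  have hcont : ContinuousAt (fun w => dist w (c i : ℂ)) (c i - 3 / 2 * I) := by fun_prop
  have hmem : (c i - 3 / 2 * I : ℂ) ∈ outerRegion c :=
    (hnear _ (by rw [hdist]; norm_num) (by rw [hdist]; norm_num)).1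
  rw [hfF]
  refine eqOn_zero_of_eventually hF hmem ?_ z.2
  filter_upwards [eventually_norm_branchRoot_lt hn hε hε1,
    hcont.eventually_const_lt (show 1 < dist (c i - 3 / 2 * I : ℂ) (c i) by rw [hdist]; norm_num),
    hcont.eventually_lt_const (show dist (c i - 3 / 2 * I : ℂ) (c i) < 2 by rw [hdist]; norm_num)]
    with w hw h1 h2
  have h3 := h0 ⟨w, hnear w h1 h2⟩ hw
  simp only [sheets_apply, pow_one, mul_one] at h3
  rw [← h3, hfF]

theorem coverRing_isDomain (hε : 0 < ε) (hε1 : ε < 1)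
    (hc : ∀ i j, i ≠ j → 4 ≤ dist (c i) (c j)) : IsDomain (coverRing c ε) := by
  have hnt : Nontrivial (coverRing c ε) := (coverPolynomial_injective (c := c)).nontrivial
  have : NoZeroDivisors (coverRing c ε) := by
    refine ⟨fun {f f'} hff' => ?_⟩
    by_contra! h
    obtain ⟨F, hF, -, -, hfF⟩ := (mem_coverRing.1 f.2).1 1
    obtain ⟨F', hF', -, -, hfF'⟩ := (mem_coverRing.1 f'.2).1 1
    have h1 : f.1 1 ≠ 0 := fun h0 => h.1 (eq_zero_of_apply_one hε hε1 hc h0)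
    obtain ⟨z, hz⟩ := Function.ne_iff.1 h1
    rw [hfF] at hz
    refine h.2 (eq_zero_of_apply_one hε hε1 hc (funext fun w => ?_))
    rw [hfF']
    refine eqOn_zero_of_eventually hF' z.2 ?_ w.2
    filter_upwards [(hF.continuousOn.continuousAt
      (isOpen_outerRegion.mem_nhds z.2)).eventually_ne hz,
      isOpen_outerRegion.mem_nhds z.2] with x hx hxU
    have h2 := congrArg (fun f => f.1 1 ⟨x, hxU⟩) hff'
    simp only [Subring.coe_mul, Pi.mul_apply, hfF, hfF'] at h2
    exact (mul_eq_zero.1 h2).resolve_left hx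
  exact NoZeroDivisors.to_isDomain _

theorem exists_ringHom_real_ne_zero (hε : 0 < ε) (hε1 : ε < 1)
    (hc : ∀ i j, i ≠ j → 4 ≤ dist (c i) (c j)) {f : coverRing c ε} (hf : f ≠ 0) :
    ∃ e : coverRing c ε →+* ℝ, e f ≠ 0 := by
  obtain ⟨R, hR⟩ := exists_forall_ge_mem_outerRegion c
  have him : ∀ (x : ℝ) (hx : R ≤ x) (f : coverRing c ε), (f.1 1 ⟨x, hR x hx⟩).im = 0 := by
    intro x hx f
    obtain ⟨F, -, -, hconj, hfF⟩ := (mem_coverRing.1 f.2).1 1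
    rw [hfF, ← conj_eq_iff_im, ← hconj _ (hR x hx), conj_ofReal]
  by_contra! h
  apply hf
  refine eq_zero_of_apply_one hε hε1 hc (funext fun z => ?_)
  obtain ⟨F, hF, -, -, hfF⟩ := (mem_coverRing.1 f.2).1 1
  rw [hfF]
  refine eqOn_zero_of_real hF (R := R) (fun x hx => ?_) z.2
  have h1 := h
    { toFun := fun f => (f.1 1 ⟨x, hR x hx⟩).re
      map_one' := rfl
      map_zero' := rfl
      map_add' := fun _ _ => rfl
      map_mul' := fun f f' => by
        simp only [Subring.coe_mul, Pi.mul_apply, mul_re, him x hx f, zero_mul, sub_zero] }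
  have h2 : (f.1 1 ⟨x, hR x hx⟩).re = 0 := h1
  have h3 : f.1 1 ⟨x, hR x hx⟩ = 0 := Complex.ext h2 (him x hx f)
  rw [← h3, hfF]

end Finite

end CoverRing

section CoverRing

open Polynomial Asymptotics

variable {G : Type*}

theorem exists_entire_extension [Finite G] {c : G → ℝ}
    (hc : ∀ i j, i ≠ j → 4 ≤ dist (c i) (c j)) {E : ℂ → ℂ}
    (hE : DifferentiableOn ℂ E (outerRegion c)) {k : G → ℂ → ℂ}
    (hk : ∀ i, DifferentiableOn ℂ (k i) (ball (c i) 2))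
    (hEk : ∀ i, ∀ z ∈ nearRegion c i, E z = k i z) :
    ∃ H : ℂ → ℂ, Differentiable ℂ H ∧ EqOn H E (outerRegion c) := by
  classical
  let H : ℂ → ℂ := fun z => if z ∈ outerRegion c then E z else
    if h : ∃ i, dist z (c i) ≤ 1 then k h.choose z else 0
  have hU : EqOn H E (outerRegion c) := fun z hz => if_pos hz
  have hball : ∀ i, EqOn H (k i) (ball (c i) 2) := by
    intro i z hz
    by_cases hzU : z ∈ outerRegion c
    · rw [hU hzU, hEk i z ⟨hzU, hz⟩]
    · have hex : ∃ j, dist z (c j) ≤ 1 := by simpa [outerRegion] using hzU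
      have hH : H z = k hex.choose z := (if_neg hzU).trans (dif_pos hex)
      rw [hH]
      congr 1
      by_contra hne
      have h1 := hc _ _ hne
      rw [← isometry_ofReal.dist_eq] at h1
      have h2 := dist_triangle_left (hex.choose |> c : ℂ) (c i) z
      have h3 := hex.choose_spec
      rw [mem_ball] at hz
      linarith
  refine ⟨H, fun z => ?_, hU⟩
  by_cases hzU : z ∈ outerRegion c
  · exact (hE.differentiableAt (isOpen_outerRegion.mem_nhds hzU)).congr_of_eventuallyEq
      (hU.eventuallyEq_of_mem (isOpen_outerRegion.mem_nhds hzU))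
  · obtain ⟨i, hi⟩ : ∃ j, dist z (c j) ≤ 1 := by simpa [outerRegion] using hzU
    have hz : ball (c i : ℂ) 2 ∈ 𝓝 z := isOpen_ball.mem_nhds (by rw [mem_ball]; linarith)
    exact ((hk i).differentiableAt hz).congr_of_eventuallyEq ((hball i).eventuallyEq_of_mem hz)

theorem eventually_cobounded_mem_outerRegion [Finite G] (c : G → ℝ) :
    ∀ᶠ z in Bornology.cobounded ℂ, z ∈ outerRegion c := by
  refine Filter.eventually_all.2 fun i => ?_
  simpa only [dist_comm] using tendsto_dist_left_cobounded_atTop (c i : ℂ) |>.eventually_gt_atTop 1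

theorem differentiableAt_conj_comp_conj {f : ℂ → ℂ} {z : ℂ}
    (hf : DifferentiableAt ℂ f (starRingEnd ℂ z)) :
    DifferentiableAt ℂ (starRingEnd ℂ ∘ f ∘ starRingEnd ℂ) z := by
  simpa using hf.conj_conj

theorem dist_conj_ofReal (z : ℂ) (a : ℝ) : dist (starRingEnd ℂ z) a = dist z a := by
  conv_lhs => rw [← conj_ofReal, dist_conj_conj]

variable [Group G] [Finite G] {c : G → ℝ} {ε : ℝ}

theorem exists_coverPolynomial_mul_eq (hε : 0 < ε) (hε1 : ε < 1)
    (hc : ∀ i j, i ≠ j → 4 ≤ dist (c i) (c j)) {f : coverRing c ε} (hf : ∀ h : G, h • f = f) :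
    ∃ q p, q ≠ 0 ∧ coverPolynomial c ε q * f = coverPolynomial c ε p := by
  classical
  have := Fintype.ofFinite G
  have hf1 : ∀ g, f.1 g = f.1 1 := by
    intro g
    conv_rhs => rw [← hf g]
    rw [coverRing_smul_apply, one_mul]
  have hn : ∀ i : G, orderOf i ≠ 0 := fun i => (orderOf_pos i).ne'
  obtain ⟨F, hF, ⟨M, hM⟩, hconj, hfF⟩ := (mem_coverRing.1 f.2).1 1
  choose N h hh hsum using fun i => branchRing_exists_sum_extension (hn i) hε
    (lt_dist_of_mem_nearRegion hε1 i) ((mem_coverRing.1 f.2).2 i 1)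
  let d : G → ℝ[X] := fun i => ((X - C (c i)) ^ 2 + C (ε ^ 2)) ^ N i
  have hd0 : ∀ i, d i ≠ 0 := by
    intro i h0
    have h1 := congrArg (eval (c i)) h0
    simp [d, hε.ne'] at h1
  have hd : ∀ i (z : ℂ), aeval z (d i) = ((z - c i) ^ 2 + ε ^ 2) ^ N i := by
    intro i z
    simp [d]
  let q : ℝ[X] := ∏ i, d i
  obtain ⟨H, hH, hHE⟩ := exists_entire_extension hc (E := fun z => aeval z q * F z)
    (q.differentiable_aeval.differentiableOn.mul hF)
    (k := fun i z => aeval z (∏ j ∈ Finset.univ.erase i, d j) * (h i z / orderOf i))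
    (fun i => (Polynomial.differentiable_aeval _).differentiableOn.mul ((hh i).div_const _))
    (fun i z hz => by
      have h1 := hsum i ⟨z, hz⟩
      simp only [sheets_apply, hf1, hfF, Finset.sum_const, Finset.card_range, nsmul_eq_mul] at h1
      have h2 : (orderOf i : ℂ) ≠ 0 := Nat.cast_ne_zero.2 (hn i)
      simp only [q]
      rw [← Finset.mul_prod_erase _ _ (Finset.mem_univ i), map_mul, hd, ← h1]
      field_simp)
  obtain ⟨M', hM'⟩ := isBigO_aeval q
  obtain ⟨P, hP⟩ := exists_polynomial_of_isBigO hH (N := M' + M)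
    (((hM'.mul hM).congr_right fun z => (pow_add z M' M).symm).congr'
      ((eventually_cobounded_mem_outerRegion c).mono fun z hz => (hHE hz).symm) EventuallyEq.rfl)
  obtain ⟨R, hR⟩ := exists_forall_ge_mem_outerRegion c
  obtain ⟨p, rfl⟩ := exists_real_polynomial (p := P) (Ici_infinite R) fun x hx => by
    rw [← hP, hHE (hR x hx), ← conj_eq_iff_im, map_mul, ← hconj _ (hR x hx), ← aeval_conj,
      conj_ofReal]
  refine ⟨q, p, Finset.prod_ne_zero_iff.2 fun i _ => hd0 i, Subtype.ext ?_⟩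
  funext g z
  have h1 := (hHE z.2).symm.trans (hP z)
  rw [eval_map] at h1
  calc aeval (z : ℂ) q * f.1 g z = aeval (z : ℂ) q * F z := by rw [hf1, hfF]
    _ = _ := h1

theorem conj_stdRoot_pow_mul_branchRoot {n : ℕ} (hn : n ≠ 0) {a : ℝ} (hε : 0 < ε) {z : ℂ}
    (hz : ε < dist z a) (m : ℕ) :
    starRingEnd ℂ (stdRoot n ^ m * branchRoot a ε n (starRingEnd ℂ z))
      = (stdRoot n ^ m * branchRoot a ε n z)⁻¹ := by
  rw [branchRoot_conj n hε hz, map_mul, map_pow, map_inv₀, conj_conj, mul_inv, ← inv_pow,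
    inv_eq_conj ((isPrimitiveRoot_stdRoot hn).norm'_eq_one hn)]

theorem exists_coverRing_separating (hc : ∀ i j, i ≠ j → 4 ≤ dist (c i) (c j)) :
    ∃ ε : ℝ, 0 < ε ∧ ε < 1 ∧ ∀ g : G, g ≠ 1 → ∃ f : coverRing c ε, g • f ≠ f := by
  classical
  obtain ⟨ε, hε, hε2, hsec⟩ := exists_sections hc
  refine ⟨ε, hε, by linarith, fun g hg => ?_⟩
  obtain ⟨f, K, hf, hK, hfK, hlim⟩ := hsec (Pi.single 1 1)
  let F : G → ℂ → ℂ := fun g z => f g z + starRingEnd ℂ (f g (starRingEnd ℂ z))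
  have hconj : Tendsto (starRingEnd ℂ) (Bornology.cobounded ℂ) (Bornology.cobounded ℂ) := by
    rw [← tendsto_norm_atTop_iff_cobounded]
    simpa using tendsto_norm_cobounded_atTop (E := ℂ)
  have hFlim : ∀ g, Tendsto (F g) (Bornology.cobounded ℂ)
      (𝓝 ((Pi.single 1 1 : G → ℂ) g + starRingEnd ℂ ((Pi.single 1 1 : G → ℂ) g))) := fun g =>
    (hlim g).add ((continuous_conj.tendsto _).comp ((hlim g).comp hconj))
  have hmem : (fun g (z : outerRegion c) => F g z) ∈ coverRing c ε := by
    refine mem_coverRing.2 ⟨fun g => ⟨F g, fun z hz => ?_, ⟨0, ?_⟩, fun z _ => ?_, fun _ => rfl⟩,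
      fun i g => ?_⟩
    · refine ((hf g z hz).add (DifferentiableAt.differentiableWithinAt ?_))
      exact differentiableAt_conj_comp_conj ((hf g).differentiableAt
        (isOpen_outerRegion.mem_nhds (conj_mem_outerRegion hz)))
    · simpa using (hFlim g).isBigO_one ℂ
    · simp [F, add_comm]
    · have hn : orderOf i ≠ 0 := (orderOf_pos i).ne'
      have : sheets c i g (fun g (z : outerRegion c) => F g z) =
          ∑ j ∈ Finset.range (orderOf i),
            (branchMonomial (c i) ε (orderOf i) (nearRegion c i) (K i j g) j +
            branchMonomial (c i) ε (orderOf i) (nearRegion c i)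
              (starRingEnd ℂ ∘ K i j g ∘ starRingEnd ℂ) (-j)) := by
        funext p
        obtain ⟨m, z, hz, hz2⟩ := p
        have hz' := dist_conj_ofReal z (c i)
        simp only [sheets_apply, F]
        rw [hfK i g m z hz2 (hz i), hfK i g m _ (hz' ▸ hz2) (hz' ▸ hz i), map_sum,
          ← Finset.sum_add_distrib, Finset.sum_apply]
        refine Finset.sum_congr rfl fun j _ => ?_
        rw [map_mul, map_pow, conj_stdRoot_pow_mul_branchRoot hn hε (by linarith [hz i])]
        simp only [branchMonomial, zpow_neg, zpow_natCast, inv_pow, Pi.add_apply,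
          Function.comp_apply]
      rw [this]
      refine Subring.sum_mem _ fun j _ => Subring.add_mem _
        (Subring.subset_closure ⟨_, _, hK i j g, rfl⟩) (Subring.subset_closure ⟨_, _, ?_, rfl⟩)
      intro z hz
      refine DifferentiableAt.differentiableWithinAt (differentiableAt_conj_comp_conj
        ((hK i j g).differentiableAt (isOpen_ball.mem_nhds ?_)))
      rw [mem_ball] at hz ⊢
      rwa [dist_conj_ofReal]
  refine ⟨⟨_, hmem⟩, fun h => ?_⟩
  have h1 : ∀ z ∈ outerRegion c, F g z = F 1 z := fun z hz => by
    have h2 := congrArg (fun f => f.1 1 ⟨z, hz⟩) h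
    simpa only [coverRing_smul_apply, one_mul] using h2
  have h3 := tendsto_nhds_unique ((hFlim g).congr'
    ((eventually_cobounded_mem_outerRegion c).mono h1)) (hFlim 1)
  norm_num [hg] at h3

end CoverRing

section RealGaloisModel

open Polynomial

/-- `ψ : A →+* V` exhibits `V` as an order in a formally real Galois extension of the fraction
field of `A` with group `G`, in which nonzero elements are detected by real points. -/
structure IsRealGaloisModel (G : Type*) {A V : Type*} [Group G] [CommRing A] [CommRing V]
    [MulSemiringAction G V] (ψ : A →+* V) : Prop where
  injective : Function.Injective ψ
  smul_map : ∀ (g : G) (a : A), g • ψ a = ψ a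
  exists_mul_eq : ∀ v : V, (∀ g : G, g • v = v) → ∃ q p, q ≠ 0 ∧ ψ q * v = ψ p
  exists_smul_ne : ∀ g : G, g ≠ 1 → ∃ v : V, g • v ≠ v
  exists_real : ∀ v : V, v ≠ 0 → ∃ e : V →+* ℝ, e v ≠ 0

theorem exists_isRealGaloisModel_polynomial (G : Type u) [Group G] [Finite G] :
    ∃ (V : Type u) (_ : CommRing V) (_ : IsDomain V) (_ : MulSemiringAction G V)
      (ψ : ℝ[X] →+* V), IsRealGaloisModel G ψ := by
  let c : G → ℝ := fun i => 4 * (Finite.equivFin G i : ℕ)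
  have hc : ∀ i j, i ≠ j → 4 ≤ dist (c i) (c j) := by
    intro i j hij
    have h1 : (Finite.equivFin G i : ℕ) ≠ Finite.equivFin G j := fun h =>
      hij ((Finite.equivFin G).injective (Fin.ext h))
    have h2 : 1 ≤ dist (Finite.equivFin G i : ℕ) (Finite.equivFin G j) :=
      Nat.pairwise_one_le_dist h1
    rw [Nat.dist_eq] at h2
    rw [Real.dist_eq, ← mul_sub, abs_mul, abs_of_pos four_pos]
    linarith
  obtain ⟨ε, hε, hε1, hsep⟩ := exists_coverRing_separating hc
  exact ⟨coverRing c ε, inferInstance, coverRing_isDomain hε hε1 hc, inferInstance,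
    coverPolynomial c ε, coverPolynomial_injective, fun _ _ => rfl,
    fun v hv => exists_coverPolynomial_mul_eq hε hε1 hc hv, hsep,
    fun v hv => exists_ringHom_real_ne_zero hε hε1 hc hv⟩

variable {G A V : Type*} [Group G] [CommRing A] [CommRing V] [MulSemiringAction G V] {ψ : A →+* V}

theorem IsRealGaloisModel.comp_equiv (h : IsRealGaloisModel G ψ) {B : Type*} [CommRing B]
    (e : B ≃+* A) : IsRealGaloisModel G (ψ.comp (e : B →+* A)) where
  injective := h.injective.comp e.injective
  smul_map g a := h.smul_map g _
  exists_mul_eq v hv := by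
    obtain ⟨q, p, hq, hqp⟩ := h.exists_mul_eq v hv
    exact ⟨e.symm q, e.symm p, by simpa using hq, by simpa using hqp⟩
  exists_smul_ne := h.exists_smul_ne
  exists_real := h.exists_real

theorem IsRealGaloisModel.mapRingHom [IsDomain A] (h : IsRealGaloisModel G ψ) :
    IsRealGaloisModel G (Polynomial.mapRingHom ψ) where
  injective := Polynomial.map_injective ψ h.injective
  smul_map g p := by
    ext n
    simp [h.smul_map]
  exists_mul_eq v hv := by
    have hcoeff : ∀ n, ∀ g : G, g • v.coeff n = v.coeff n := fun n g => by
      rw [← Polynomial.coeff_smul, hv]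
    choose q p hq hqp using fun n => h.exists_mul_eq _ (hcoeff n)
    let Q := ∏ n ∈ v.support, q n
    have hlift : C (ψ Q) * v ∈ lifts ψ := by
      rw [lifts_iff_coeff_lifts]
      intro n
      rw [coeff_C_mul]
      by_cases hn : n ∈ v.support
      · refine ⟨p n * ∏ m ∈ v.support.erase n, q m, ?_⟩
        rw [map_mul, ← hqp, show Q = _ from (Finset.mul_prod_erase _ _ hn).symm, map_mul]
        ring
      · exact ⟨0, by rw [notMem_support_iff.1 hn, mul_zero, map_zero]⟩
    obtain ⟨P, hP⟩ := (mem_lifts _).1 hlift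
    exact ⟨C Q, P, C_ne_zero.2 (Finset.prod_ne_zero_iff.2 fun n _ => hq n), by
      rw [coe_mapRingHom, map_C, hP]⟩
  exists_smul_ne g hg := by
    obtain ⟨v, hv⟩ := h.exists_smul_ne g hg
    exact ⟨C v, by rwa [smul_C, Ne, C_inj]⟩
  exists_real v hv := by
    obtain ⟨n, hn⟩ : ∃ n, v.coeff n ≠ 0 := by
      by_contra! h0
      exact hv (Polynomial.ext h0)
    obtain ⟨e, he⟩ := h.exists_real _ hn
    have h1 : v.map e ≠ 0 := fun h0 => he (by rw [← coeff_map, h0, coeff_zero])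
    obtain ⟨x, hx⟩ : ∃ x, (v.map e).eval x ≠ 0 := by
      by_contra! h0
      exact h1 (Polynomial.funext fun x => by rw [h0, eval_zero])
    exact ⟨eval₂RingHom e x, by rwa [coe_eval₂RingHom, ← eval_map]⟩

theorem exists_isRealGaloisModel_mvPolynomial (G : Type u) [Group G] [Finite G] (n : ℕ) :
    ∃ (V : Type u) (_ : CommRing V) (_ : IsDomain V) (_ : MulSemiringAction G V)
      (ψ : MvPolynomial (Fin (n + 1)) ℝ →+* V), IsRealGaloisModel G ψ := by
  induction n with
  | zero =>
    obtain ⟨V, _, _, _, ψ, hψ⟩ := exists_isRealGaloisModel_polynomial G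
    exact ⟨V, _, ‹_›, _, _, hψ.comp_equiv (MvPolynomial.uniqueAlgEquiv ℝ (Fin 1)).toRingEquiv⟩
  | succ n ih =>
    obtain ⟨V, _, _, _, ψ, hψ⟩ := ih
    exact ⟨V[X], inferInstance, inferInstance, inferInstance, _,
      hψ.mapRingHom.comp_equiv (MvPolynomial.finSuccEquiv ℝ (n + 1)).toRingEquiv⟩

end RealGaloisModel

section RealGaloisField

/-- A sum of four squares in `R` vanishes only if the first term does. -/
def FourSquaresAnisotropic (R : Type*) [CommRing R] : Prop :=
  ∀ a b c d : R, a ^ 2 + b ^ 2 + c ^ 2 + d ^ 2 = 0 → a = 0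

variable {G A V : Type*} [Group G] [CommRing A] [CommRing V] [MulSemiringAction G V] {ψ : A →+* V}

theorem IsRealGaloisModel.fourSquaresAnisotropic (h : IsRealGaloisModel G ψ) :
    FourSquaresAnisotropic V := by
  intro a b c d habcd
  by_contra ha
  obtain ⟨e, he⟩ := h.exists_real a ha
  have h1 := congrArg e habcd
  simp only [map_add, map_pow, map_zero] at h1
  have h2 := pow_pos (abs_pos.2 he) 2
  rw [sq_abs] at h2
  linarith [sq_nonneg (e b), sq_nonneg (e c), sq_nonneg (e d)]

theorem FourSquaresAnisotropic.of_isFractionRing [IsDomain V] (h : FourSquaresAnisotropic V)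
    (L : Type*) [Field L] [Algebra V L] [IsFractionRing V L] : FourSquaresAnisotropic L := by
  intro a b c d habcd
  obtain ⟨a, a', ha, rfl⟩ := IsFractionRing.div_surjective V a
  obtain ⟨b, b', hb, rfl⟩ := IsFractionRing.div_surjective V b
  obtain ⟨c, c', hc, rfl⟩ := IsFractionRing.div_surjective V c
  obtain ⟨d, d', hd, rfl⟩ := IsFractionRing.div_surjective V d
  have hne : ∀ {x : V}, x ∈ nonZeroDivisors V → algebraMap V L x ≠ 0 := fun hx =>
    IsFractionRing.to_map_ne_zero_of_mem_nonZeroDivisors hx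
  have ha0 := hne ha
  have hb0 := hne hb
  have hc0 := hne hc
  have hd0 := hne hd
  have h1 : (a * b' * c' * d') ^ 2 + (b * a' * c' * d') ^ 2 + (c * a' * b' * d') ^ 2
      + (d * a' * b' * c') ^ 2 = 0 := by
    apply IsFractionRing.injective V L
    field_simp at habcd
    simp only [map_add, map_pow, map_mul, map_zero]
    linear_combination habcd
  have h2 := h _ _ _ _ h1
  simp only [mul_eq_zero, nonZeroDivisors.ne_zero hb, nonZeroDivisors.ne_zero hc,
    nonZeroDivisors.ne_zero hd, or_false] at h2
  simp [h2]

theorem FourSquaresAnisotropic.of_injective {R S : Type*} [CommRing R] [CommRing S]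
    (h : FourSquaresAnisotropic S) {f : R →+* S} (hf : Function.Injective f) :
    FourSquaresAnisotropic R := fun a b c d habcd => hf <| by
  rw [map_zero]
  exact h (f a) (f b) (f c) (f d) (by simp only [← map_pow, ← map_add, habcd, map_zero])

theorem IsRealGaloisModel.exists_field [Finite G] [IsDomain A] [IsDomain V]
    (h : IsRealGaloisModel G ψ) (K L : Type*) [Field K] [Algebra A K] [IsFractionRing A K]
    [Field L] [Algebra V L] [IsFractionRing V L] :
    ∃ (_ : MulSemiringAction G L) (j : K →+* L), FaithfulSMul G L ∧
      ∀ x : L, (∀ g : G, g • x = x) ↔ x ∈ Set.range j := by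
  classical
  have := Fintype.ofFinite G
  let := IsFractionRing.mulSemiringAction G V L
  have hsmul : ∀ (g : G) (v : V), g • algebraMap V L v = algebraMap V L (g • v) := fun g v =>
    (algebraMap.coe_smul' g v L).symm
  have hinj : Function.Injective ((algebraMap V L).comp ψ) :=
    (IsFractionRing.injective V L).comp h.injective
  let j : K →+* L := IsFractionRing.lift hinj
  have hj : ∀ a, j (algebraMap A K a) = algebraMap V L (ψ a) := fun a =>
    IsFractionRing.lift_algebraMap hinj a
  have hne : ∀ {x : V}, x ≠ 0 → algebraMap V L x ≠ 0 := fun hx => by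
    simpa using hx
  have hfix : ∀ v : V, (∀ g : G, g • v = v) → algebraMap V L v ∈ j.fieldRange := by
    intro v hv
    obtain ⟨q, p, hq, hqp⟩ := h.exists_mul_eq v hv
    have hq0 : algebraMap V L (ψ q) ≠ 0 := hne fun h0 => hq (h.injective (h0.trans ψ.map_zero.symm))
    refine ⟨algebraMap A K p / algebraMap A K q, ?_⟩
    rw [map_div₀, hj, hj, ← hqp, map_mul, mul_div_cancel_left₀ _ hq0]
  refine ⟨this, j, ⟨fun {g g'} hgg' => ?_⟩, fun x => ⟨fun hx => ?_, ?_⟩⟩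
  · by_contra hne'
    obtain ⟨v, hv⟩ := h.exists_smul_ne (g'⁻¹ * g) fun h0 => hne' (inv_mul_eq_one.1 h0).symm
    apply hv
    apply IsFractionRing.injective V L
    rw [← hsmul, mul_smul, hgg', inv_smul_smul]
  · obtain ⟨a, b, hb, rfl⟩ := IsFractionRing.div_surjective V x
    set x := algebraMap V L a / algebraMap V L b
    have hb0 : ∏ g : G, g • b ≠ 0 := Finset.prod_ne_zero_iff.2 fun g _ =>
      (smul_ne_zero_iff_ne g).2 (nonZeroDivisors.ne_zero hb)
    have hbfix : ∀ g : G, g • ∏ g' : G, g' • b = ∏ g' : G, g' • b := by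
      intro g
      rw [Finset.smul_prod']
      simp only [← mul_smul]
      exact Fintype.prod_equiv (Equiv.mulLeft g) _ _ fun _ => rfl
    have hxa : x * algebraMap V L (∏ g : G, g • b)
        = algebraMap V L (a * ∏ g ∈ Finset.univ.erase (1 : G), g • b) := by
      rw [← Finset.mul_prod_erase _ _ (Finset.mem_univ (1 : G)), one_smul, map_mul, ← mul_assoc,
        div_mul_cancel₀ _ (hne (nonZeroDivisors.ne_zero hb)), map_mul]
    have h1 := hfix _ hbfix
    have h2 := hfix (a * ∏ g ∈ Finset.univ.erase (1 : G), g • b) fun g => by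
      apply IsFractionRing.injective V L
      rw [← hsmul, ← hxa, smul_mul', hx, hsmul, hbfix]
    rw [← hxa] at h2
    have h3 := div_mem h2 h1
    rwa [mul_div_cancel_right₀ _ (hne hb0)] at h3
  · rintro ⟨y, rfl⟩ g
    obtain ⟨a, b, -, rfl⟩ := IsFractionRing.div_surjective A y
    rw [map_div₀, hj, hj, smul_div₀', hsmul, hsmul, h.smul_map, h.smul_map]

end RealGaloisField

section GaloisAction

theorem isGaloisExt_of_action {F M G : Type*} [DivisionRing F] [DivisionRing M] [Group G]
    {ι : F →+* M} (Φ : G →* RingAut M) (hΦ : Function.Injective Φ)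
    (hfix : ∀ g x, Φ g (ι x) = ι x)
    (hsurj : ∀ σ : RingAut M, (∀ x, σ (ι x) = ι x) → ∃ g, Φ g = σ)
    (hrange : ∀ m, (∀ g, Φ g m = m) → m ∈ Set.range ι) :
    IsGaloisExt ι ∧ Nonempty (fixingAut ι ≃* G) := by
  refine ⟨fun m hm => hrange m fun g => hm _ (hfix g), ⟨MulEquiv.symm <| MulEquiv.ofBijective
    (Φ.codRestrict (fixingAut ι) hfix) ⟨fun g g' h => hΦ (congrArg Subtype.val h), fun σ => ?_⟩⟩⟩
  obtain ⟨g, hg⟩ := hsurj σ.1 σ.2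
  exact ⟨g, Subtype.ext hg⟩

end GaloisAction

section QuaternionGalois

open Quaternion

theorem FourSquaresAnisotropic.isUnit_or_eq_zero {L : Type*} [Field L]
    (h : FourSquaresAnisotropic L) (x : ℍ[L]) : IsUnit x ∨ x = 0 := by
  by_cases hx : normSq x = 0
  · right
    rw [normSq_def'] at hx
    ext
    · exact h _ _ _ _ hx
    · exact h _ x.re x.imJ x.imK (by linear_combination hx)
    · exact h _ x.re x.imI x.imK (by linear_combination hx)
    · exact h _ x.re x.imI x.imJ (by linear_combination hx)
  · left
    refine isUnit_iff_exists.2 ⟨star x * ((normSq x)⁻¹ : L), ?_, ?_⟩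
    · rw [← mul_assoc, self_mul_star, ← coe_mul, mul_inv_cancel₀ hx, coe_one]
    · rw [← coe_commutes, mul_assoc, star_mul_self, ← coe_mul, inv_mul_cancel₀ hx, coe_one]

theorem FourSquaresAnisotropic.two_ne_zero {L : Type*} [Field L]
    (h : FourSquaresAnisotropic L) : (2 : L) ≠ 0 := fun h2 =>
  one_ne_zero (h 1 1 0 0 (by linear_combination h2))

/-- Quaternions over a field in which sums of four squares are anisotropic form a division ring. -/
noncomputable abbrev FourSquaresAnisotropic.divisionRing {L : Type*} [Field L]
    (h : FourSquaresAnisotropic L) : DivisionRing ℍ[L] :=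
  haveI : Nontrivial ℍ[L] := inferInstance
  DivisionRing.ofIsUnitOrEqZero h.isUnit_or_eq_zero

/-- The quaternion with given coordinates. -/
def quaternionMk {R : Type*} [CommRing R] (a b c d : R) : ℍ[R] := ⟨a, b, c, d⟩

section quaternionMk

variable {R : Type*} [CommRing R] (a b c d : R)

@[simp] theorem re_quaternionMk : (quaternionMk a b c d).re = a := rfl

@[simp] theorem imI_quaternionMk : (quaternionMk a b c d).imI = b := rfl

@[simp] theorem imJ_quaternionMk : (quaternionMk a b c d).imJ = c := rfl

@[simp] theorem imK_quaternionMk : (quaternionMk a b c d).imK = d := rfl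

end quaternionMk

/-- The map on quaternions induced by a ring homomorphism on coefficients. -/
def quaternionMap {R S : Type*} [CommRing R] [CommRing S] (f : R →+* S) : ℍ[R] →+* ℍ[S] where
  toFun x := quaternionMk (f x.re) (f x.imI) (f x.imJ) (f x.imK)
  map_one' := by ext <;> simp
  map_zero' := by ext <;> simp
  map_add' x y := by ext <;> simp
  map_mul' x y := by ext <;> simp

theorem quaternionMap_apply {R S : Type*} [CommRing R] [CommRing S] (f : R →+* S) (x : ℍ[R]) :
    quaternionMap f x = quaternionMk (f x.re) (f x.imI) (f x.imJ) (f x.imK) := rfl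

theorem quaternion_eq_sum {R : Type*} [CommRing R] (x : ℍ[R]) :
    x = (x.re : ℍ[R]) + (x.imI : ℍ[R]) * quaternionMk 0 1 0 0
      + (x.imJ : ℍ[R]) * quaternionMk 0 0 1 0 + (x.imK : ℍ[R]) * quaternionMk 0 0 0 1 := by
  ext <;> simp

/-- The coefficientwise action of `G` on quaternions by ring automorphisms. -/
def quaternionAut (G L : Type*) [Group G] [CommRing L] [MulSemiringAction G L] :
    G →* RingAut ℍ[L] where
  toFun g :=
    { quaternionMap (MulSemiringAction.toRingHom G L g) with
      invFun := quaternionMap (MulSemiringAction.toRingHom G L g⁻¹)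
      left_inv := fun x => by ext <;> simp [quaternionMap_apply]
      right_inv := fun x => by ext <;> simp [quaternionMap_apply] }
  map_one' := by
    ext x <;> simp [quaternionMap_apply]
  map_mul' g g' := by
    ext x <;> simp [quaternionMap_apply, mul_smul]

theorem quaternionAut_apply {G L : Type*} [Group G] [CommRing L] [MulSemiringAction G L] (g : G)
    (x : ℍ[L]) : quaternionAut G L g x =
      quaternionMk (g • x.re) (g • x.imI) (g • x.imJ) (g • x.imK) := rfl

theorem eq_coe_re_of_commute {L : Type*} [Field L] (h2 : (2 : L) ≠ 0) {x : ℍ[L]}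
    (hi : Commute x (quaternionMk 0 1 0 0)) (hj : Commute x (quaternionMk 0 0 1 0)) : x = x.re := by
  have key : ∀ a : L, -a = a → a = 0 := fun a ha => by
    have : 2 * a = 0 := by linear_combination -ha
    simpa [h2] using this
  have h1 := congrArg QuaternionAlgebra.imJ hi.eq
  have h3 := congrArg QuaternionAlgebra.imK hi.eq
  have h4 := congrArg QuaternionAlgebra.imK hj.eq
  simp at h1 h3 h4
  ext
  · simp
  · simpa using key _ h4.symm
  · simpa using key _ h3
  · simpa using key _ h1.symm

variable {G K L : Type*} [Group G] [Finite G] [Field K] [Field L] [MulSemiringAction G L]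
  [FaithfulSMul G L] {j : K →+* L}

theorem exists_quaternionAut_eq (hj : ∀ x : L, (∀ g : G, g • x = x) ↔ x ∈ Set.range j)
    (h2 : (2 : L) ≠ 0) (σ : RingAut ℍ[L])
    (hσ : ∀ x, σ (quaternionMap j x) = quaternionMap j x) : ∃ g : G, quaternionAut G L g = σ := by
  have hi : σ (quaternionMk 0 1 0 0) = quaternionMk 0 1 0 0 := by
    simpa [quaternionMap_apply] using hσ (quaternionMk 0 1 0 0)
  have hj' : σ (quaternionMk 0 0 1 0) = quaternionMk 0 0 1 0 := by
    simpa [quaternionMap_apply] using hσ (quaternionMk 0 0 1 0)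
  have hk : σ (quaternionMk 0 0 0 1) = quaternionMk 0 0 0 1 := by
    simpa [quaternionMap_apply] using hσ (quaternionMk 0 0 0 1)
  have hcoe : ∀ l : L, σ l = ((σ l).re : ℍ[L]) := fun l => by
    refine eq_coe_re_of_commute h2 ?_ ?_
    · have := (coe_commute l (quaternionMk 0 1 0 0)).map σ
      rwa [hi] at this
    · have := (coe_commute l (quaternionMk 0 0 1 0)).map σ
      rwa [hj'] at this
  have hinj : Function.Injective ((↑) : L → ℍ[L]) := coe_injective
  let τ : L →ₐ[FixedPoints.subfield G L] L :=
    { toFun := fun l => (σ l).re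
      map_one' := by simp
      map_zero' := by simp
      map_add' := fun a b => by simp
      map_mul' := fun a b => hinj <| (hcoe (a * b)).symm.trans <|
        calc σ ((a * b : L) : ℍ[L]) = σ a * σ b := by rw [coe_mul, map_mul]
          _ = (σ a).re * (σ b).re := congrArg₂ (· * ·) (hcoe a) (hcoe b)
          _ = _ := (coe_mul _ _).symm
      commutes' := fun r => by
        obtain ⟨y, hy⟩ := (hj r).1 r.2
        have h1 := hσ y
        have h3 : quaternionMap j y = ((r : L) : ℍ[L]) := by
          ext <;> simp [quaternionMap_apply, hy]
        rw [h3] at h1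
        exact congrArg QuaternionAlgebra.re h1 }
  obtain ⟨g, hg⟩ := (FixedPoints.toAlgHom_bijective G L).surjective τ
  have hg' : ∀ l : L, g • l = (σ l).re := fun l => DFunLike.congr_fun hg l
  refine ⟨g, RingEquiv.ext fun x => ?_⟩
  conv_rhs => rw [quaternion_eq_sum x]
  simp only [map_add, map_mul, hi, hj', hk]
  rw [hcoe x.re, hcoe x.imI, hcoe x.imJ, hcoe x.imK, quaternionAut_apply]
  simp only [hg']
  exact quaternion_eq_sum _

theorem quaternion_isGaloisExt (hj : ∀ x : L, (∀ g : G, g • x = x) ↔ x ∈ Set.range j)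
    (hL : FourSquaresAnisotropic L) {F : Type*} [DivisionRing F] (e : F ≃+* ℍ[K]) :
    letI := hL.divisionRing
    ∃ ι : F →+* ℍ[L], Function.Injective ι ∧ IsGaloisExt ι ∧ Nonempty (fixingAut ι ≃* G) := by
  let := hL.divisionRing
  refine ⟨(quaternionMap j).comp (e : F →+* ℍ[K]), RingHom.injective _,
    isGaloisExt_of_action (quaternionAut G L) (fun g g' h => ?_) (fun g x => ?_) (fun σ hσ => ?_)
    fun m hm => ?_⟩
  · refine eq_of_smul_eq_smul fun l : L => ?_
    exact congrArg QuaternionAlgebra.re (DFunLike.congr_fun h (l : ℍ[L]))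
  · have h1 : ∀ (g : G) (y : K), g • j y = j y := fun g y => (hj (j y)).2 ⟨y, rfl⟩ g
    rw [quaternionAut_apply]
    simp [quaternionMap_apply, h1]
  · refine exists_quaternionAut_eq hj hL.two_ne_zero σ fun x => ?_
    simpa using hσ (e.symm x)
  · have h1 : ∀ f : ℍ[L] → L, (∀ g : G, f (quaternionAut G L g m) = g • f m) →
        f m ∈ Set.range j := fun f hf => (hj _).1 fun g => by rw [← hf, hm]
    obtain ⟨a, ha⟩ := h1 QuaternionAlgebra.re fun _ => rfl
    obtain ⟨b, hb⟩ := h1 QuaternionAlgebra.imI fun _ => rfl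
    obtain ⟨c, hc⟩ := h1 QuaternionAlgebra.imJ fun _ => rfl
    obtain ⟨d, hd⟩ := h1 QuaternionAlgebra.imK fun _ => rfl
    refine ⟨e.symm (quaternionMk a b c d), ?_⟩
    ext <;> simp [quaternionMap_apply, ha, hb, hc, hd]

end QuaternionGalois

section QuotientRingOfQuaternionOrder

open Quaternion

theorem map_commute_of_isClassicalRightQuotient {R F : Type*} [Ring R] [DivisionRing F]
    {φ : R →+* F} (hφ : IsClassicalRightQuotient φ) {a : R} (ha : ∀ r, Commute a r) (x : F) :
    Commute (φ a) x := by
  obtain ⟨r, s, -, rfl⟩ := hφ.2 x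
  exact ((ha r).map φ).mul_right ((ha s).map φ).inv_right₀

theorem exists_central_ringHom_of_isClassicalRightQuotient {A R F : Type*} (K : Type*)
    [CommRing A] [IsDomain A] [Field K] [Algebra A K] [IsFractionRing A K] [Ring R]
    [DivisionRing F] {φ : R →+* F} (hφ : IsClassicalRightQuotient φ) {α : A →+* R}
    (hα : Function.Injective α) (hcomm : ∀ a r, Commute (α a) r) :
    ∃ κ : K →+* F, (∀ a, κ (algebraMap A K a) = φ (α a)) ∧ ∀ a x, Commute (κ a) x := by
  let β : A →+* Subring.center F := (φ.comp α).codRestrict _ fun a =>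
    Subring.mem_center_iff.2 fun x =>
      (map_commute_of_isClassicalRightQuotient hφ (hcomm a) x).eq.symm
  have hβ : Function.Injective β := fun a b h => hα (hφ.1 (congrArg Subtype.val h))
  refine ⟨(Subring.center F).subtype.comp (IsFractionRing.lift hβ), fun a => ?_, fun a x => ?_⟩
  · rw [RingHom.comp_apply, IsFractionRing.lift_algebraMap]
    rfl
  · exact (Subring.mem_center_iff.1 (IsFractionRing.lift hβ a).2 x).symm

/-- The division ring of quotients of a ring spanned by the quaternion units over a central
subdomain `A` is the quaternion algebra over the fraction field of `A`. -/
theorem nonempty_ringEquiv_quaternion {A R F : Type*} (K : Type*)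
    [CommRing A] [IsDomain A] [Field K] [Algebra A K] [IsFractionRing A K] [Ring R]
    [DivisionRing F] (hK : FourSquaresAnisotropic K)
    {φ : R →+* F} (hφ : IsClassicalRightQuotient φ) {α : A →+* R}
    (hα : Function.Injective α) (hcomm : ∀ a r, Commute (α a) r) {i j : R}
    (hi : i * i = -1) (hj : j * j = -1) (hij : j * i = -(i * j))
    (hspan : ∀ r, ∃ a b c d, r = α a + α b * i + α c * j + α d * (i * j)) :
    Nonempty (F ≃+* ℍ[K]) := by
  obtain ⟨κ, hκ, hcen⟩ := exists_central_ringHom_of_isClassicalRightQuotient K hφ hα hcomm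
  let _ : Algebra K F := κ.toAlgebra' fun a x => (hcen a x).eq
  let q : QuaternionAlgebra.Basis F (-1 : K) 0 (-1) :=
    { i := φ i
      j := φ j
      k := φ i * φ j
      i_mul_i := by rw [← map_mul, hi]; simp
      j_mul_j := by rw [← map_mul, hj]; simp
      i_mul_j := rfl
      j_mul_i := by rw [← map_mul, hij]; simp }
  let f : ℍ[K] →+* F := (q.liftHom : _ →ₐ[K] F).toRingHom
  let _ := hK.divisionRing
  have hrange (r : R) : ∃ x, f x = φ r := by
    obtain ⟨a, b, c, d, rfl⟩ := hspan r
    refine ⟨quaternionMk (algebraMap A K a) (algebraMap A K b) (algebraMap A K c)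
      (algebraMap A K d), ?_⟩
    change κ _ + κ _ * φ i + κ _ * φ j + κ _ * (φ i * φ j) = _
    simp [hκ]
  refine ⟨(RingEquiv.ofBijective f ⟨f.injective, fun x => ?_⟩).symm⟩
  obtain ⟨a, b, hb, rfl⟩ := hφ.2 x
  obtain ⟨y, hy⟩ := hrange a
  obtain ⟨z, hz⟩ := hrange b
  obtain ⟨w, rfl⟩ | rfl := hK.isUnit_or_eq_zero z
  · exact ⟨y * ↑w⁻¹, by rw [map_mul, map_units_inv, hy, hz]⟩
  · exact absurd (hφ.1 (hz.symm.trans (f.map_zero.trans φ.map_zero.symm))) hb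

end QuotientRingOfQuaternionOrder

section PolyFunRing

open Quaternion

theorem const_mem_polyFunRing {H : Type*} [DivisionRing H] (c : H) :
    Function.const H c ∈ polyFunRing H :=
  Subring.subset_closure (Or.inl ⟨c, rfl⟩)

theorem id_mem_polyFunRing {H : Type*} [DivisionRing H] : (id : H → H) ∈ polyFunRing H :=
  Subring.subset_closure (Or.inr rfl)

theorem coe_re_eq_conjugates (y : ℍ[ℝ]) :
    ((y.re : ℝ) : ℍ[ℝ]) = ((4⁻¹ : ℝ) : ℍ[ℝ]) *
      (y - quaternionMk 0 1 0 0 * y * quaternionMk 0 1 0 0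
        - quaternionMk 0 0 1 0 * y * quaternionMk 0 0 1 0
        - quaternionMk 0 0 0 1 * y * quaternionMk 0 0 0 1) := by
  ext <;> simp [-coe_inv, -map_inv₀]
  ring

theorem coe_re_mul_mem_polyFunRing (c : ℍ[ℝ]) :
    (fun x : ℍ[ℝ] => (((c * x).re : ℝ) : ℍ[ℝ])) ∈ polyFunRing ℍ[ℝ] := by
  simp_rw [coe_re_eq_conjugates]
  have hm : (Function.const _ c * id : ℍ[ℝ] → ℍ[ℝ]) ∈ polyFunRing ℍ[ℝ] :=
    mul_mem (const_mem_polyFunRing c) id_mem_polyFunRing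
  have hconj (d : ℍ[ℝ]) : (Function.const _ d * (Function.const _ c * id) * Function.const _ d :
      ℍ[ℝ] → ℍ[ℝ]) ∈ polyFunRing ℍ[ℝ] :=
    mul_mem (mul_mem (const_mem_polyFunRing d) hm) (const_mem_polyFunRing d)
  exact mul_mem (const_mem_polyFunRing _)
    (sub_mem (sub_mem (sub_mem hm (hconj _)) (hconj _)) (hconj _))

/-- The four real coordinates of a quaternion. -/
def quaternionCoord (x : ℍ[ℝ]) : Fin 4 → ℝ := ![x.re, x.imI, x.imJ, x.imK]

theorem coe_quaternionCoord_mem_polyFunRing (n : Fin 4) :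
    (fun x : ℍ[ℝ] => ((quaternionCoord x n : ℝ) : ℍ[ℝ])) ∈ polyFunRing ℍ[ℝ] := by
  fin_cases n
  · simpa [quaternionCoord] using coe_re_mul_mem_polyFunRing 1
  · simpa [quaternionCoord] using coe_re_mul_mem_polyFunRing (quaternionMk 0 (-1) 0 0)
  · simpa [quaternionCoord] using coe_re_mul_mem_polyFunRing (quaternionMk 0 0 (-1) 0)
  · simpa [quaternionCoord] using coe_re_mul_mem_polyFunRing (quaternionMk 0 0 0 (-1))

theorem coe_eval_quaternionCoord_mem_polyFunRing (p : MvPolynomial (Fin 4) ℝ) :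
    (fun x : ℍ[ℝ] => ((MvPolynomial.eval (quaternionCoord x) p : ℝ) : ℍ[ℝ])) ∈
      polyFunRing ℍ[ℝ] := by
  induction p using MvPolynomial.induction_on with
  | C a =>
    simp only [MvPolynomial.eval_C]
    exact const_mem_polyFunRing (a : ℍ[ℝ])
  | add p q hp hq =>
    simp only [map_add, coe_add]
    exact add_mem hp hq
  | mul_X p n hp =>
    simp only [map_mul, MvPolynomial.eval_X, coe_mul]
    exact mul_mem hp (coe_quaternionCoord_mem_polyFunRing n)

/-- Real polynomials in the four coordinates, as polynomial functions on the quaternions. -/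
noncomputable def coordPolyFun : MvPolynomial (Fin 4) ℝ →+* polyFunRing ℍ[ℝ] :=
  (RingHom.pi fun x =>
    (algebraMap ℝ ℍ[ℝ]).comp (MvPolynomial.eval (quaternionCoord x))).codRestrict _
    coe_eval_quaternionCoord_mem_polyFunRing

theorem coordPolyFun_apply (p : MvPolynomial (Fin 4) ℝ) (x : ℍ[ℝ]) :
    (coordPolyFun p : ℍ[ℝ] → ℍ[ℝ]) x = (MvPolynomial.eval (quaternionCoord x) p : ℝ) := rfl

theorem coordPolyFun_injective : Function.Injective coordPolyFun := by
  intro p q h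
  refine MvPolynomial.funext fun v => ?_
  have hv := congrFun (congrArg Subtype.val h) (quaternionMk (v 0) (v 1) (v 2) (v 3))
  have hc : quaternionCoord (quaternionMk (v 0) (v 1) (v 2) (v 3)) = v := by
    ext n
    fin_cases n <;> rfl
  rwa [coordPolyFun_apply, coordPolyFun_apply, hc, coe_inj] at hv

theorem commute_coordPolyFun (p : MvPolynomial (Fin 4) ℝ) (r : polyFunRing ℍ[ℝ]) :
    Commute (coordPolyFun p) r :=
  Subtype.ext <| funext fun _ => coe_commutes _ _

/-- The constant polynomial function. -/
def constPolyFun {H : Type*} [DivisionRing H] : H →+* polyFunRing H :=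
  (Pi.constRingHom H H).codRestrict _ const_mem_polyFunRing

theorem exists_coordPolyFun_eq (r : polyFunRing ℍ[ℝ]) :
    ∃ a b c d, r = coordPolyFun a + coordPolyFun b * constPolyFun (quaternionMk 0 1 0 0) +
      coordPolyFun c * constPolyFun (quaternionMk 0 0 1 0) + coordPolyFun d *
        (constPolyFun (quaternionMk 0 1 0 0) * constPolyFun (quaternionMk 0 0 1 0)) := by
  suffices h : ∀ f ∈ polyFunRing ℍ[ℝ], ∃ a : Fin 4 → MvPolynomial (Fin 4) ℝ, ∀ x,
      quaternionCoord (f x) = fun n => MvPolynomial.eval (quaternionCoord x) (a n) by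
    obtain ⟨a, ha⟩ := h r r.2
    refine ⟨a 0, a 1, a 2, a 3, Subtype.ext <| funext fun x => ?_⟩
    have hmul : constPolyFun (quaternionMk (0 : ℝ) 1 0 0) * constPolyFun (quaternionMk 0 0 1 0) =
        constPolyFun (quaternionMk 0 0 0 1) := by
      rw [← map_mul]
      congr 1
      ext <;> simp
    rw [hmul]
    change r.1 x = ((MvPolynomial.eval (quaternionCoord x) (a 0) : ℝ) : ℍ[ℝ]) +
      ((MvPolynomial.eval (quaternionCoord x) (a 1) : ℝ) : ℍ[ℝ]) * quaternionMk 0 1 0 0 +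
      ((MvPolynomial.eval (quaternionCoord x) (a 2) : ℝ) : ℍ[ℝ]) * quaternionMk 0 0 1 0 +
      ((MvPolynomial.eval (quaternionCoord x) (a 3) : ℝ) : ℍ[ℝ]) * quaternionMk 0 0 0 1
    simp_rw [← congrFun (ha x)]
    exact quaternion_eq_sum _
  intro f hf
  induction hf using Subring.closure_induction with
  | mem f hf =>
    obtain ⟨c, rfl⟩ | rfl := hf
    · exact ⟨fun n => MvPolynomial.C (quaternionCoord c n), fun x => by simp⟩
    · exact ⟨MvPolynomial.X, fun x => by simp⟩
  | zero => exact ⟨0, fun x => by ext n; fin_cases n <;> simp [quaternionCoord]⟩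
  | one => exact ⟨![1, 0, 0, 0], fun x => by ext n; fin_cases n <;> simp [quaternionCoord]⟩
  | add f g _ _ hf hg =>
    obtain ⟨a, ha⟩ := hf
    obtain ⟨b, hb⟩ := hg
    refine ⟨a + b, fun x => ?_⟩
    simp_rw [Pi.add_apply, map_add, ← congrFun (ha x), ← congrFun (hb x)]
    ext n
    fin_cases n <;> simp [quaternionCoord]
  | neg f _ hf =>
    obtain ⟨a, ha⟩ := hf
    refine ⟨-a, fun x => ?_⟩
    simp_rw [Pi.neg_apply, map_neg, ← congrFun (ha x)]
    ext n
    fin_cases n <;> simp [quaternionCoord]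
  | mul f g _ _ hf hg =>
    obtain ⟨a, ha⟩ := hf
    obtain ⟨b, hb⟩ := hg
    refine ⟨![a 0 * b 0 - a 1 * b 1 - a 2 * b 2 - a 3 * b 3,
      a 0 * b 1 + a 1 * b 0 + a 2 * b 3 - a 3 * b 2,
      a 0 * b 2 - a 1 * b 3 + a 2 * b 0 + a 3 * b 1,
      a 0 * b 3 + a 1 * b 2 - a 2 * b 1 + a 3 * b 0], fun x => ?_⟩
    ext n
    fin_cases n <;> simp [← congrFun (ha x), ← congrFun (hb x)] <;> simp [quaternionCoord]

/-- The division ring of fractions of the polynomial functions on the real quaternions is the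
quaternion algebra over the field of rational functions in four variables. -/
theorem nonempty_ringEquiv_quaternion_of_polyFunRing (K : Type*) [Field K]
    [Algebra (MvPolynomial (Fin 4) ℝ) K] [IsFractionRing (MvPolynomial (Fin 4) ℝ) K]
    (hK : FourSquaresAnisotropic K) {F : Type*} [DivisionRing F]
    {φ : polyFunRing ℍ[ℝ] →+* F} (hφ : IsClassicalRightQuotient φ) :
    Nonempty (F ≃+* ℍ[K]) := by
  refine nonempty_ringEquiv_quaternion K hK hφ coordPolyFun_injective commute_coordPolyFun
    ?_ ?_ ?_ exists_coordPolyFun_eq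
  · rw [← map_mul, ← map_one constPolyFun, ← map_neg]
    congr 1
    ext <;> simp
  · rw [← map_mul, ← map_one constPolyFun, ← map_neg]
    congr 1
    ext <;> simp
  · rw [← map_mul, ← map_mul, ← map_neg]
    congr 1
    ext <;> simp

end PolyFunRing

end InverseGalois

/-- Every finite group is the Galois group of a Galois extension of the
classical right field of fractions of the ring of polynomial functions on Hamilton's
quaternions. -/
theorem inverse_galois_over_quaternion_polyFun_fractions
    {F : Type u} [DivisionRing F]
    (φ : polyFunRing (Quaternion ℝ) →+* F) (hφ : IsClassicalRightQuotient φ)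
    (G : Type v) [Group G] [Finite G] :
    ∃ (M : Type u) (instM : DivisionRing M),
      letI := instM
      ∃ ι : F →+* M, Function.Injective ι ∧ IsGaloisExt ι ∧
        Nonempty (fixingAut ι ≃* G) := by
  obtain ⟨V, _, _, _, ψ, hψ⟩ := exists_isRealGaloisModel_mvPolynomial (Shrink.{u} G) 3
  have hL := hψ.fourSquaresAnisotropic.of_isFractionRing (FractionRing V)
  obtain ⟨_, j, _, hj⟩ := hψ.exists_field (FractionRing (MvPolynomial (Fin 4) ℝ)) (FractionRing V)
  obtain ⟨e⟩ := nonempty_ringEquiv_quaternion_of_polyFunRing _ (hL.of_injective j.injective) hφ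
  obtain ⟨ι, hι, hgal, ⟨ε⟩⟩ := quaternion_isGaloisExt hj hL e
  exact ⟨_, hL.divisionRing, ι, hι, hgal, ⟨ε.trans Shrink.mulEquiv⟩⟩
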